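/- arXiv:2508.00182 — 2 statements merged into one kernel-verified Lean document; each statement's English description precedes it below -/
import Mathlib

section
/- Let π ∈ S' and let τ^π = τ_{F^π}. Consider the d-multiple Walsh series with coefficients a_𝐧 = (τ^π)̂_𝐧 (the Fourier–Walsh coefficients of τ^π). Then a_𝟎 = 1, so not all coefficients vanish, and for every 𝐠 ∈ 𝔾^d ∖ F^π this series converges to 0 over rectangles; consequently it also converges to 0 over cubes and iteratedly for every order of iterated summation at every such 𝐠. Hence F^π is an M-set for the d-dimensional Walsh system under rectangular convergence, convergence over cubes, and iterated convergence in any order. -/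
open Filter Finset Topology MeasureTheory
open scoped Classical

noncomputable section

instance : TopologicalSpace (ZMod 2) := ⊥
instance : DiscreteTopology (ZMod 2) := ⟨rfl⟩

/-- The dyadic (Cantor) group `𝔾`: sequences of elements of `ℤ/2ℤ`
with coordinatewise addition modulo 2, Tychonoff topology. -/
abbrev DyadicGroup : Type := ℕ → ZMod 2

instance : MeasurableSpace DyadicGroup := borel _
instance : BorelSpace DyadicGroup := ⟨rfl⟩

/-- `𝔾^d`. -/
abbrev GD (d : ℕ) : Type := Fin d → DyadicGroup

/-- One-dimensional Walsh function `W_n` in the Paley enumeration: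
`W_n(g) = ∏_k (-1)^(g_k n_k)`. -/
def walsh (n : ℕ) (g : DyadicGroup) : ℝ :=
  ∏ k ∈ Finset.range n, if n.testBit k ∧ g k = 1 then (-1 : ℝ) else 1

/-- `d`-dimensional Walsh function `W_𝐧(𝐠) = ∏ W_{n^l}(g^l)`. -/
def walshD {d : ℕ} (n : Fin d → ℕ) (g : GD d) : ℝ :=
  ∏ l, walsh (n l) (g l)

/-- The dyadic interval `Δ^{(k)}_m` of rank `k`. -/
def dyadicInterval (k m : ℕ) : Set DyadicGroup :=
  {g | ∀ t < k, g t = if m.testBit (k - 1 - t) then 1 else 0}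

/-- The dyadic cube `Δ^{(k)}_𝐦 = Δ^{(k)}_{m^1} × ⋯ × Δ^{(k)}_{m^d}`. -/
def dyadicCube {d : ℕ} (k : ℕ) (m : Fin d → ℕ) : Set (GD d) :=
  {g | ∀ l, g l ∈ dyadicInterval k (m l)}

/-- The canonical point of `Δ^{(k)}_m`. -/
def intervalPoint (k m : ℕ) : DyadicGroup :=
  fun t => if t < k ∧ m.testBit (k - 1 - t) then 1 else 0

/-- The canonical point of `Δ^{(k)}_𝐦`. -/
def cubePoint {d : ℕ} (k : ℕ) (m : Fin d → ℕ) : GD d :=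
  fun l => intervalPoint k (m l)

/-- `W^{(k)}_{n,m}`: the (constant, for `n < 2^k`) value of `W_n` on `Δ^{(k)}_m`. -/
def walshVal (k n m : ℕ) : ℝ := walsh n (intervalPoint k m)

/-- `W^{(k)}_{𝐧𝐦}`: the (constant, for `𝐧 < 2^k·𝟏`) value of `W_𝐧` on `Δ^{(k)}_𝐦`. -/
def walshValD {d : ℕ} (k : ℕ) (n m : Fin d → ℕ) : ℝ := walshD n (cubePoint k m)

/-- The box `{𝐧 : 𝐧 < 𝐍}` as a finset. -/
def boxLt {d : ℕ} (N : Fin d → ℕ) : Finset (Fin d → ℕ) :=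
  Fintype.piFinset fun l => Finset.range (N l)

/-- The box `{0,…,2^k−1}^d` as a set. -/
def box (d k : ℕ) : Set (Fin d → ℕ) := {m | ∀ l, m l < 2 ^ k}

/-- The rectangular partial sum `S_𝐍(𝐠)` of the Walsh series with coefficients `a`. -/
def walshPartialSum {d : ℕ} (a : (Fin d → ℕ) → ℂ) (N : Fin d → ℕ) (g : GD d) : ℂ :=
  ∑ n ∈ boxLt N, a n * (walshD n g : ℂ)

/-- Convergence over rectangles: `S_𝐍(𝐠) → S` as `min_j N^j → ∞`. -/
def ConvergesOverRectangles {d : ℕ} (a : (Fin d → ℕ) → ℂ) (g : GD d) (S : ℂ) : Prop :=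
  Tendsto (fun N : Fin d → ℕ => walshPartialSum a N g) atTop (𝓝 S)

/-- Convergence over cubes: `S_{N𝟏}(𝐠) → S` as `N → ∞`. -/
def ConvergesOverCubes {d : ℕ} (a : (Fin d → ℕ) → ℂ) (g : GD d) (S : ℂ) : Prop :=
  Tendsto (fun N : ℕ => walshPartialSum a (fun _ => N) g) atTop (𝓝 S)

/-- `λ`-convergence: `S_𝐍(𝐠) → S` as `min_j N^j → ∞` along `𝐍` with `max N^j/N^k ≤ λ`. -/
def LambdaConverges {d : ℕ} (lam : ℝ) (a : (Fin d → ℕ) → ℂ) (g : GD d) (S : ℂ) : Prop :=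
  ∀ ε : ℝ, 0 < ε → ∃ K : ℕ, ∀ N : Fin d → ℕ, (∀ j, K ≤ N j) →
    (∀ j k, (N j : ℝ) ≤ lam * N k) → ‖walshPartialSum a N g - S‖ < ε

/-- Auxiliary predicate for iterated summation of a multiple series with terms `f`;
the list gives the order of summation, *innermost index first*.  After summing the
series in the variables of the list, the remaining (partially summed) function is `g`. -/
def IterConvAux {d : ℕ} : List (Fin d) → ((Fin d → ℕ) → ℂ) → ((Fin d → ℕ) → ℂ) → Prop
  | [], f, g => f = g
  | j :: rest, f, g => ∃ h : (Fin d → ℕ) → ℂ,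
      (∀ n, Tendsto (fun T : ℕ => ∑ t ∈ Finset.range T, f (Function.update n j t))
        atTop (𝓝 (h n))) ∧ IterConvAux rest h g

/-- The multiple series with terms `f` converges iteratedly to `S`, the order of
summation being given by the list `l` (innermost index first): all successively
nested inner series converge and the full iterated sum equals `S`. -/
def IterConverges {d : ℕ} (l : List (Fin d)) (f : (Fin d → ℕ) → ℂ) (S : ℂ) : Prop :=
  ∃ g, IterConvAux l f g ∧ ∀ n, g n = S

/-- `A` is an M-set for the `d`-dimensional Walsh system under rectangular convergence. -/
def IsMSetRect {d : ℕ} (A : Set (GD d)) : Prop :=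
  ∃ a : (Fin d → ℕ) → ℂ, (∃ n, a n ≠ 0) ∧ ∀ g ∉ A, ConvergesOverRectangles a g 0

/-- `A` is an M-set for the `d`-dimensional Walsh system under convergence over cubes. -/
def IsMSetCubes {d : ℕ} (A : Set (GD d)) : Prop :=
  ∃ a : (Fin d → ℕ) → ℂ, (∃ n, a n ≠ 0) ∧ ∀ g ∉ A, ConvergesOverCubes a g 0

/-- `A` is an M-set under iterated convergence with summation order `l` (innermost first). -/
def IsMSetIter {d : ℕ} (A : Set (GD d)) (l : List (Fin d)) : Prop :=
  ∃ a : (Fin d → ℕ) → ℂ, (∃ n, a n ≠ 0) ∧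
    ∀ g ∉ A, IterConverges l (fun n => a n * (walshD n g : ℂ)) 0

/-- `A` is an M-set for the `d`-dimensional Walsh system under `λ`-convergence. -/
def IsMSetLambda {d : ℕ} (lam : ℝ) (A : Set (GD d)) : Prop :=
  ∃ a : (Fin d → ℕ) → ℂ, (∃ n, a n ≠ 0) ∧ ∀ g ∉ A, LambdaConverges lam a g 0

/-- A quasimeasure: a finitely additive function on dyadic cubes (indexed by rank
`k` and position `𝐦 < 2^k·𝟏`). -/
def IsQuasimeasure {d : ℕ} (τ : ℕ → (Fin d → ℕ) → ℂ) : Prop :=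
  ∀ k m, (∀ l, m l < 2 ^ k) →
    τ k m = ∑ σ : Fin d → Fin 2, τ (k + 1) fun l => 2 * m l + (σ l : ℕ)

/-- The quasimeasure generated by the Walsh series with coefficients `a`:
`τ(Δ^{(k)}_𝐦) = 2^{-kd} ∑_{𝐧<2^k𝟏} a_𝐧 W_𝐧(Δ^{(k)}_𝐦)`. -/
def genQM {d : ℕ} (a : (Fin d → ℕ) → ℂ) (k : ℕ) (m : Fin d → ℕ) : ℂ :=
  ((2 : ℂ) ^ (k * d))⁻¹ * ∑ n ∈ boxLt (fun _ : Fin d => 2 ^ k), a n * (walshValD k n m : ℂ)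

/-- The Fourier–Walsh coefficient `τ̂_𝐧` of a quasimeasure `τ`, computed at resolution `k`
(the value does not depend on `k` as long as `𝐧 < 2^k𝟏`). -/
def fourierCoeffAt {d : ℕ} (τ : ℕ → (Fin d → ℕ) → ℂ) (n : Fin d → ℕ) (k : ℕ) : ℂ :=
  ∑ m ∈ boxLt (fun _ : Fin d => 2 ^ k), (walshValD k n m : ℂ) * τ k m

/-- The local Fourier–Walsh coefficient `τ̂_𝐧(Δ^{(r)}_{𝐦Δ})`, computed at resolution `k ≥ r`. -/
def localCoeffAt {d : ℕ} (τ : ℕ → (Fin d → ℕ) → ℂ) (n : Fin d → ℕ)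
    (r : ℕ) (mΔ : Fin d → ℕ) (k : ℕ) : ℂ :=
  ∑ m ∈ (boxLt (fun _ : Fin d => 2 ^ k)).filter
      (fun m => dyadicCube k m ⊆ dyadicCube r mΔ),
    (walshValD k n m : ℂ) * τ k m

/-- The support of a quasimeasure: the complement of the union of all dyadic cubes `Δ₀`
such that `τ(Δ) = 0` for every dyadic cube `Δ ⊆ Δ₀`. -/
def qmSupport {d : ℕ} (τ : ℕ → (Fin d → ℕ) → ℂ) : Set (GD d) :=
  (⋃ k, ⋃ m ∈ box d k,
    ⋃ (_ : ∀ k' m', (∀ l, m' l < 2 ^ k') →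
        dyadicCube k' m' ⊆ dyadicCube k m → τ k' m' = 0),
    dyadicCube k m)ᶜ

/-- The restriction `τ|_{Δ̃}` of a quasimeasure to the dyadic cube `Δ̃ = Δ^{(r)}_{𝐦Δ}`:
`τ|_{Δ̃}(Δ) = τ(Δ̃ ∩ Δ)` (two dyadic cubes are nested or disjoint). -/
def restrictQM {d : ℕ} (τ : ℕ → (Fin d → ℕ) → ℂ) (r : ℕ) (mΔ : Fin d → ℕ) :
    ℕ → (Fin d → ℕ) → ℂ := fun k m =>
  if dyadicCube k m ⊆ dyadicCube (d := d) r mΔ then τ k m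
  else if dyadicCube (d := d) r mΔ ⊆ dyadicCube k m then τ r mΔ
  else 0

/-- `τ` is the canonical quasimeasure `τ_E` associated with a (nonempty closed) set `E`:
`τ(𝔾^d) = 1`; `τ(Δ) = 0` iff `Δ ∩ E = ∅`; and the mass of a cube meeting `E` is divided
equally among its `2^d` immediate subcubes that meet `E`. -/
def IsTauOf {d : ℕ} (E : Set (GD d)) (τ : ℕ → (Fin d → ℕ) → ℂ) : Prop :=
  IsQuasimeasure τ ∧
  τ 0 (fun _ => 0) = 1 ∧
  (∀ k m, (∀ l, m l < 2 ^ k) → (τ k m = 0 ↔ dyadicCube k m ∩ E = ∅)) ∧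
  (∀ k m, (∀ l, m l < 2 ^ k) → (dyadicCube k m ∩ E).Nonempty →
    ∀ σ : Fin d → Fin 2,
      τ (k + 1) (fun l => 2 * m l + (σ l : ℕ)) =
        if (dyadicCube (k + 1) (fun l => 2 * m l + (σ l : ℕ)) ∩ E).Nonempty then
          τ k m / ((Finset.univ.filter fun σ' : Fin d → Fin 2 =>
              (dyadicCube (k + 1) (fun l => 2 * m l + (σ' l : ℕ)) ∩ E).Nonempty).card : ℂ)
        else 0)

/-- The sequence `m_s`: `m_1 = 0`, `m_{s+1} = 2(2m_s+1)` (value at `0` is junk). -/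
def mSeq : ℕ → ℕ
  | 0 => 0
  | s + 1 => if s = 0 then 0 else 2 * (2 * mSeq s + 1)

/-- The layer `F_s^π`. -/
def Fspi {d : ℕ} (π : ℕ → (Fin d → ℕ) → Fin d → ℕ) (s : ℕ) : Set (GD d) :=
  ⋃ m ∈ box d (mSeq s), ⋃ m' ∈ box d (mSeq s),
    {g | g ∈ dyadicCube (2 * mSeq s) (fun l => 2 ^ mSeq s * m l + m' l) ∧
      walshD (fun _ => 2 ^ (2 * mSeq s)) g = walshValD (mSeq s) (π s m) m'}

/-- `F̃_s^π = F_1^π ∩ ⋯ ∩ F_s^π` (so `F̃_0^π = 𝔾^d`). -/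
def Ftil {d : ℕ} (π : ℕ → (Fin d → ℕ) → Fin d → ℕ) (s : ℕ) : Set (GD d) :=
  ⋂ k ∈ Finset.Icc 1 s, Fspi π k

/-- `F^π = ⋂_{s≥1} F_s^π`. -/
def Fpi {d : ℕ} (π : ℕ → (Fin d → ℕ) → Fin d → ℕ) : Set (GD d) :=
  ⋂ s ∈ Set.Ici 1, Fspi π s

/-- The identity element of `S` (yielding `F_s`, `F̃_s` and `F` themselves). -/
def idPerm (d : ℕ) : ℕ → (Fin d → ℕ) → Fin d → ℕ := fun _ m => m

/-- `S`: sequences `π = (π_s)` of permutations of the boxes `{0,…,2^{m_s}−1}^d`. -/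
structure PermSeq (d : ℕ) where
  p : ℕ → Equiv.Perm (Fin d → ℕ)
  maps : ∀ s, Set.MapsTo (p s) (box d (mSeq s)) (box d (mSeq s))

/-- The underlying sequence of functions of an element of `S`. -/
def PermSeq.f {d : ℕ} (π : PermSeq d) : ℕ → (Fin d → ℕ) → Fin d → ℕ := fun s => ⇑(π.p s)

/-- `π ∈ S'`: every `π_s` acts coordinatewise, `π_s(𝐦) = (π_s^1(m^1),…,π_s^d(m^d))`. -/
def PermSeq.Coordinatewise {d : ℕ} (π : PermSeq d) : Prop :=
  ∀ s, ∃ e : Fin d → ℕ → ℕ, ∀ m : Fin d → ℕ, π.p s m = fun l => e l (m l)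

/-- The Dirichlet kernel `D_N = ∑_{n<N} W_n` of the one-dimensional Walsh system. -/
def dirichlet (N : ℕ) (g : DyadicGroup) : ℝ :=
  ∑ n ∈ Finset.range N, walsh n g

namespace Aux15

/-! ### One-dimensional Walsh functions -/

lemma walsh_eq (n k : ℕ) (h : n < 2 ^ k) (g : DyadicGroup) :
    walsh n g = ∏ t ∈ Finset.range k, if n.testBit t ∧ g t = 1 then (-1 : ℝ) else 1 := by
  unfold walsh
  have key : ∀ j, n < 2 ^ j →
      (∏ t ∈ Finset.range j, if n.testBit t ∧ g t = 1 then (-1 : ℝ) else 1)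
      = ∏ t ∈ Finset.range (max n k), if n.testBit t ∧ g t = 1 then (-1 : ℝ) else 1 := by
    intro j hj
    rcases le_total j (max n k) with h1 | h1
    · apply Finset.prod_subset
      · intro x hx; simp only [Finset.mem_range] at *; omega
      · intro x _ hx
        simp only [Finset.mem_range, not_lt] at hx
        have : n.testBit x = false :=
          Nat.testBit_lt_two_pow (lt_of_lt_of_le hj (Nat.pow_le_pow_right (by norm_num) hx))
        simp [this]
    · symm
      apply Finset.prod_subset
      · intro x hx; simp only [Finset.mem_range] at *; omega
      · intro x _ hx
        simp only [Finset.mem_range, not_lt] at hx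
        have : n.testBit x = false :=
          Nat.testBit_lt_two_pow (lt_of_lt_of_le Nat.lt_two_pow_self
            (Nat.pow_le_pow_right (by norm_num) (le_trans (le_max_left n k) hx)))
        simp [this]
  rw [key k h, key n Nat.lt_two_pow_self]

lemma walsh_congr {n k : ℕ} (h : n < 2 ^ k) {g g' : DyadicGroup} (hg : ∀ t < k, g t = g' t) :
    walsh n g = walsh n g' := by
  rw [walsh_eq n k h, walsh_eq n k h]
  apply Finset.prod_congr rfl
  intro t ht
  rw [hg t (Finset.mem_range.1 ht)]

lemma walsh_zero (g : DyadicGroup) : walsh 0 g = 1 := by simp [walsh]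

lemma walsh_one (g : DyadicGroup) : walsh 1 g = if g 0 = 1 then -1 else 1 := by
  simp [walsh]

lemma walsh_sq (n : ℕ) (g : DyadicGroup) : walsh n g * walsh n g = 1 := by
  unfold walsh
  rw [← Finset.prod_mul_distrib]
  apply Finset.prod_eq_one
  intro t _
  split_ifs <;> norm_num

lemma walsh_abs (n : ℕ) (g : DyadicGroup) : |walsh n g| = 1 := by
  have h := walsh_sq n g
  rcases mul_self_eq_one_iff.1 h with h | h <;> simp [h]

/-- the shifted point -/
def sh (m : ℕ) (g : DyadicGroup) : DyadicGroup := fun t => g (m + t)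

lemma walsh_split (m y q : ℕ) (hq : q < 2 ^ m) (g : DyadicGroup) :
    walsh (2 ^ m * y + q) g = walsh q g * walsh y (sh m g) := by
  have hy : y < 2 ^ y := Nat.lt_two_pow_self
  have hn : 2 ^ m * y + q < 2 ^ (m + y) := by
    rw [pow_add]
    calc 2 ^ m * y + q < 2 ^ m * y + 2 ^ m := by omega
      _ = 2 ^ m * (y + 1) := by ring
      _ ≤ 2 ^ m * 2 ^ y := Nat.mul_le_mul_left _ hy
  rw [walsh_eq _ _ hn, walsh_eq q m hq, walsh_eq y y hy, Finset.prod_range_add]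
  congr 1
  · apply Finset.prod_congr rfl
    intro t ht
    rw [Nat.testBit_two_pow_mul_add _ hq, if_pos (Finset.mem_range.1 ht)]
  · apply Finset.prod_congr rfl
    intro t ht
    rw [Nat.testBit_two_pow_mul_add _ hq, if_neg (Nat.not_lt.2 (Nat.le_add_right m t)), Nat.add_sub_cancel_left]
    rfl

lemma walsh_top (m : ℕ) (g : DyadicGroup) : walsh (2 ^ m) g = if g m = 1 then -1 else 1 := by
  have := walsh_split m 1 0 (by positivity) g
  simp only [mul_one, add_zero] at this
  rw [this, walsh_zero, walsh_one]
  simp [sh]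

lemma zmod2_cases (x : ZMod 2) : x = 0 ∨ x = 1 := by
  revert x; decide

lemma walsh_kernel (m : ℕ) (g h : DyadicGroup) :
    ∑ q ∈ Finset.range (2 ^ m), walsh q g * walsh q h
      = if ∀ t < m, g t = h t then (2 : ℝ) ^ m else 0 := by
  induction m with
  | zero => simp [walsh_zero]
  | succ m ih =>
    rw [pow_succ, mul_two, Finset.sum_range_add]
    have h2 : ∀ q ∈ Finset.range (2 ^ m), walsh (2 ^ m + q) g * walsh (2 ^ m + q) h
        = (walsh 1 (sh m g) * walsh 1 (sh m h)) * (walsh q g * walsh q h) := by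
      intro q hq
      have hq := Finset.mem_range.1 hq
      have a := walsh_split m 1 q hq g
      have b := walsh_split m 1 q hq h
      rw [mul_one] at a b
      rw [a, b]; ring
    rw [Finset.sum_congr rfl h2, ← Finset.mul_sum, ih]
    have hiff : (∀ t < m + 1, g t = h t) ↔ (∀ t < m, g t = h t) ∧ g m = h m := by
      constructor
      · intro H; exact ⟨fun t ht => H t (by omega), H m (by omega)⟩
      · rintro ⟨H1, H2⟩ t ht
        rcases Nat.lt_succ_iff_lt_or_eq.1 ht with ht | rfl
        · exact H1 t ht
        · exact H2
    have hw : walsh 1 (sh m g) * walsh 1 (sh m h) = if g m = h m then (1 : ℝ) else -1 := by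
      simp only [walsh_one, sh, add_zero]
      rcases zmod2_cases (g m) with h1 | h1 <;> rcases zmod2_cases (h m) with h2 | h2 <;>
        simp [h1, h2]
    rw [hw]
    simp only [hiff]
    by_cases hA : ∀ t < m, g t = h t <;> by_cases hB : g m = h m
    · rw [if_pos hA, if_pos hB, if_pos ⟨hA, hB⟩]; ring
    · rw [if_pos hA, if_neg hB, if_neg (fun H => hB H.2)]; ring
    · rw [if_neg hA, mul_zero, add_zero, if_neg (fun H => hA H.1)]
    · rw [if_neg hA, mul_zero, add_zero, if_neg (fun H => hA H.1)]

lemma walsh_kernel_bound_triv (B : ℕ) (g h : DyadicGroup) :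
    |∑ q ∈ Finset.range B, walsh q g * walsh q h| ≤ B := by
  refine (Finset.abs_sum_le_sum_abs _ _).trans ?_
  simp [abs_mul, walsh_abs]

lemma walsh_kernel_bound (B j : ℕ) (g h : DyadicGroup) (hj : ∃ t < j, g t ≠ h t) :
    |∑ q ∈ Finset.range B, walsh q g * walsh q h| ≤ 2 ^ j := by
  have blk : ∀ y r, r ≤ 2 ^ j →
      ∑ q ∈ Finset.range r, walsh (2 ^ j * y + q) g * walsh (2 ^ j * y + q) h
      = (walsh y (sh j g) * walsh y (sh j h)) *
        ∑ q ∈ Finset.range r, walsh q g * walsh q h := by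
    intro y r hr
    rw [Finset.mul_sum]
    apply Finset.sum_congr rfl
    intro q hq
    have hq : q < 2 ^ j := lt_of_lt_of_le (Finset.mem_range.1 hq) hr
    rw [walsh_split _ _ _ hq, walsh_split _ _ _ hq]; ring
  have z : ∀ A, ∑ q ∈ Finset.range (2 ^ j * A), walsh q g * walsh q h = 0 := by
    intro A
    induction A with
    | zero => simp
    | succ A ih =>
      rw [mul_add, mul_one, Finset.sum_range_add, ih, blk _ _ le_rfl, walsh_kernel, if_neg]
      · simp
      · push Not; exact hj
  have hr : B % 2 ^ j < 2 ^ j := Nat.mod_lt _ (by positivity)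
  rw [← Nat.div_add_mod B (2 ^ j), Finset.sum_range_add, z, blk _ _ hr.le, zero_add, abs_mul,
    abs_mul, walsh_abs, walsh_abs, one_mul, one_mul]
  refine (walsh_kernel_bound_triv _ _ _).trans ?_
  exact_mod_cast hr.le

/-! ### Dyadic intervals and indices -/

/-- index of the rank-`k` interval containing `x` -/
def idx : ℕ → DyadicGroup → ℕ
  | 0, _ => 0
  | k + 1, x => 2 * idx k x + (x k).val

lemma idx_lt (k : ℕ) (x : DyadicGroup) : idx k x < 2 ^ k := by
  induction k with
  | zero => simp [idx]
  | succ k ih =>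
    have := (x k).val_lt
    simp only [idx]; rw [pow_succ]; omega

lemma idx_congr (k : ℕ) {x y : DyadicGroup} (h : ∀ t < k, x t = y t) : idx k x = idx k y := by
  induction k with
  | zero => rfl
  | succ k ih =>
    simp only [idx]
    rw [ih (fun t ht => h t (by omega)), h k (by omega)]

lemma idx_add (k j : ℕ) (x : DyadicGroup) : idx (k + j) x = 2 ^ j * idx k x + idx j (sh k x) := by
  induction j with
  | zero => simp [idx]
  | succ j ih =>
    rw [← add_assoc]
    simp only [idx, ih, sh]; ring

lemma mem_dyadicInterval_succ (k m : ℕ) (x : DyadicGroup) :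
    x ∈ dyadicInterval (k + 1) m ↔
      x ∈ dyadicInterval k (m / 2) ∧ (x k).val = m % 2 := by
  simp only [dyadicInterval, Set.mem_ofPred_eq]
  have hk : (x k = if m.testBit 0 then 1 else 0) ↔ (x k).val = m % 2 := by
    rw [Nat.testBit_zero]
    rcases zmod2_cases (x k) with h | h <;> rcases Nat.mod_two_eq_zero_or_one m with h' | h' <;>
      simp [h, h', ZMod.val_one]
  constructor
  · intro H
    refine ⟨fun t ht => ?_, hk.1 ?_⟩
    · have := H t (by omega)
      rw [show k + 1 - 1 - t = (k - 1 - t) + 1 by omega, Nat.testBit_succ] at this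
      exact this
    · have := H k (by omega)
      simpa using this
  · rintro ⟨H1, H2⟩ t ht
    rcases Nat.lt_succ_iff_lt_or_eq.1 ht with ht | rfl
    · rw [show k + 1 - 1 - t = (k - 1 - t) + 1 by omega, Nat.testBit_succ]
      exact H1 t ht
    · have := hk.2 H2
      simpa using this

lemma mem_dyadicInterval_iff (k m : ℕ) (hm : m < 2 ^ k) (x : DyadicGroup) :
    x ∈ dyadicInterval k m ↔ idx k x = m := by
  induction k generalizing m with
  | zero =>
    have : m = 0 := by simpa using hm
    subst this
    simp [dyadicInterval, idx]
  | succ k ih =>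
    rw [mem_dyadicInterval_succ, ih _ (by rw [pow_succ] at hm; omega)]
    simp only [idx]
    have := (x k).val_lt
    omega

lemma ip_mem (k m : ℕ) : intervalPoint k m ∈ dyadicInterval k m := by
  intro t ht
  simp [intervalPoint, ht]

lemma idx_ip {k m : ℕ} (hm : m < 2 ^ k) : idx k (intervalPoint k m) = m :=
  (mem_dyadicInterval_iff k m hm _).1 (ip_mem k m)

lemma ip_idx (k : ℕ) (x : DyadicGroup) : ∀ t < k, intervalPoint k (idx k x) t = x t := by
  intro t ht
  have h := (mem_dyadicInterval_iff k (idx k x) (idx_lt k x) x).2 rfl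
  rw [h t ht, ip_mem k _ t ht]

lemma idx_inj {k : ℕ} {x y : DyadicGroup} (h : idx k x = idx k y) : ∀ t < k, x t = y t := by
  intro t ht
  rw [← ip_idx k x t ht, h, ip_idx k y t ht]

lemma ip_child (k m b : ℕ) (hb : b < 2) :
    (∀ t < k, intervalPoint (k + 1) (2 * m + b) t = intervalPoint k m t) ∧
      (intervalPoint (k + 1) (2 * m + b) k).val = b := by
  have h := ip_mem (k + 1) (2 * m + b)
  rw [mem_dyadicInterval_succ] at h
  constructor
  · intro t ht
    have h1 := h.1
    rw [show (2 * m + b) / 2 = m by omega] at h1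
    rw [h1 t ht, ip_mem k m t ht]
  · rw [h.2]; omega

lemma walshVal_symm (k n x : ℕ) (hn : n < 2 ^ k) (hx : x < 2 ^ k) :
    walsh n (intervalPoint k x) = walsh x (intervalPoint k n) := by
  rw [walsh_eq n k hn, walsh_eq x k hx, ← Finset.prod_range_reflect]
  apply Finset.prod_congr rfl
  intro t ht
  have ht := Finset.mem_range.1 ht
  have e1 : k - 1 - t < k := by omega
  have e2 : k - 1 - (k - 1 - t) = t := by omega
  simp [intervalPoint, ht, e1, e2, and_comm]

lemma walsh_orth (k n n' : ℕ) (hn : n < 2 ^ k) (hn' : n' < 2 ^ k) :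
    ∑ x ∈ Finset.range (2 ^ k), walsh n (intervalPoint k x) * walsh n' (intervalPoint k x)
      = if n = n' then (2 : ℝ) ^ k else 0 := by
  have : ∀ x ∈ Finset.range (2 ^ k), walsh n (intervalPoint k x) * walsh n' (intervalPoint k x)
      = walsh x (intervalPoint k n) * walsh x (intervalPoint k n') := by
    intro x hx
    have hx := Finset.mem_range.1 hx
    rw [walshVal_symm k n x hn hx, walshVal_symm k n' x hn' hx]
  rw [Finset.sum_congr rfl this, walsh_kernel]
  congr 1
  apply propext
  constructor
  · intro H
    rw [← idx_ip hn, ← idx_ip hn', idx_congr k H]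
  · rintro rfl t _; rfl

/-! ### The layers -/

/-- number of digits involved in the first `s` layers -/
def KK : ℕ → ℕ
  | 0 => 0
  | s + 1 => 4 * KK s + 1

lemma mSeq_succ (s : ℕ) : mSeq (s + 1) = 2 * KK s := by
  induction s with
  | zero => simp [mSeq, KK]
  | succ s ih =>
    rw [mSeq, if_neg (by omega), ih, KK]; ring

lemma KK_ge (s : ℕ) : s ≤ KK s := by
  induction s with
  | zero => simp
  | succ s ih => simp only [KK]; omega

lemma KK_mono : StrictMono KK := by
  apply strictMono_nat_of_lt_succ
  intro s; simp only [KK]; omega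

lemma KK_ge' (s : ℕ) : 2 * s ≤ KK s + 1 := by
  induction s with
  | zero => simp
  | succ s ih => 
    have := KK_ge s
    simp only [KK]; omega

/-- the sign of a digit -/
def sg (x : ZMod 2) : ℝ := if x = 1 then -1 else 1

lemma sg_add_one (x : ZMod 2) : sg (x + 1) = - sg x := by
  rcases zmod2_cases x with h | h
  · simp [h, sg]
  · rw [h, show (1 : ZMod 2) + 1 = 0 by decide]; simp [sg]

section layers

variable {d : ℕ}

/-- the part of the sign of layer `s+1` that depends on the digits before the last one -/
def QQ (e : ℕ → Fin d → ℕ → ℕ) (s : ℕ) (g : GD d) : ℝ :=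
  ∏ l, walsh (e s l (idx (2 * KK s) (g l))) (sh (2 * KK s) (g l))

/-- the sign of layer `s+1` -/
def RR (e : ℕ → Fin d → ℕ → ℕ) (s : ℕ) (g : GD d) : ℝ :=
  ∏ l, walsh (2 ^ (2 * KK s) + e s l (idx (2 * KK s) (g l))) (sh (2 * KK s) (g l))

/-- the density of the first `s` layers -/
def ff (e : ℕ → Fin d → ℕ → ℕ) (s : ℕ) (g : GD d) : ℝ :=
  ∏ i ∈ Finset.range s, (1 + RR e i g)

/-- agreement of digits before `k` -/
def Agree (k : ℕ) (g g' : GD d) : Prop := ∀ l, ∀ t < k, g l t = g' l t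

/-- admissible coordinatewise permutations -/
def Adm (e : ℕ → Fin d → ℕ → ℕ) : Prop :=
  ∀ s l, ∀ x < 2 ^ (2 * KK s), e s l x < 2 ^ (2 * KK s)

variable {e : ℕ → Fin d → ℕ → ℕ}

lemma RR_eq (he : Adm e) (s : ℕ) (g : GD d) :
    RR e s g = QQ e s g * ∏ l, sg (g l (4 * KK s)) := by
  unfold RR QQ
  rw [← Finset.prod_mul_distrib]
  apply Finset.prod_congr rfl
  intro l _
  have := walsh_split (2 * KK s) 1 _ (he s l _ (idx_lt _ (g l))) (sh (2 * KK s) (g l))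
  rw [mul_one] at this
  rw [this, walsh_one]
  congr 1
  simp only [sh, sg, add_zero]
  rw [show 2 * KK s + 2 * KK s = 4 * KK s by ring]

lemma QQ_congr (he : Adm e) (s : ℕ) {g g' : GD d} (h : Agree (4 * KK s) g g') :
    QQ e s g = QQ e s g' := by
  unfold QQ
  apply Finset.prod_congr rfl
  intro l _
  rw [idx_congr _ (fun t ht => h l t (by omega) : ∀ t < 2 * KK s, g l t = g' l t)]
  apply walsh_congr (he s l _ (idx_lt _ (g' l)))
  intro t ht
  exact h l _ (by omega)

lemma RR_congr (he : Adm e) (s : ℕ) {g g' : GD d} (h : Agree (KK (s + 1)) g g') :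
    RR e s g = RR e s g' := by
  rw [RR_eq he, RR_eq he, QQ_congr he s (fun l t ht => h l t (by simp only [KK]; omega))]
  congr 1
  apply Finset.prod_congr rfl
  intro l _
  rw [h l _ (by simp only [KK]; omega)]

lemma RR_cases (s : ℕ) (g : GD d) : RR e s g = 1 ∨ RR e s g = -1 := by
  apply mul_self_eq_one_iff.1
  unfold RR
  rw [← Finset.prod_mul_distrib]
  exact Finset.prod_eq_one fun l _ => walsh_sq _ _

lemma ff_succ (s : ℕ) (g : GD d) : ff e (s + 1) g = ff e s g * (1 + RR e s g) := by
  simp [ff, Finset.prod_range_succ]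

lemma ff_congr (he : Adm e) (s : ℕ) {g g' : GD d} (h : Agree (KK s) g g') :
    ff e s g = ff e s g' := by
  unfold ff
  apply Finset.prod_congr rfl
  intro i hi
  rw [RR_congr he i]
  intro l t ht
  exact h l t (lt_of_lt_of_le ht (KK_mono.monotone (Finset.mem_range.1 hi)))

lemma ff_nonneg (s : ℕ) (g : GD d) : 0 ≤ ff e s g := by
  apply Finset.prod_nonneg
  intro i _
  rcases RR_cases (e := e) i g with h | h <;> rw [h] <;> norm_num

lemma ff_le (s : ℕ) (g : GD d) : ff e s g ≤ 2 ^ s := by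
  induction s with
  | zero => simp [ff]
  | succ s ih =>
    rw [ff_succ, pow_succ]
    have := ff_nonneg (e := e) s g
    rcases RR_cases (e := e) s g with h | h <;> rw [h] <;> nlinarith

lemma ff_ne_zero (s : ℕ) (g : GD d) : ff e s g ≠ 0 ↔ ∀ i < s, RR e i g = 1 := by
  unfold ff
  rw [Finset.prod_ne_zero_iff]
  simp only [Finset.mem_range]
  refine forall₂_congr fun i _ => ?_
  rcases RR_cases (e := e) i g with h | h <;> rw [h] <;> norm_num

/-- flip one digit -/
def flip (l0 : Fin d) (t0 : ℕ) (g : GD d) : GD d :=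
  fun l t => if l = l0 ∧ t = t0 then g l t + 1 else g l t

lemma flip_of_ne (l0 : Fin d) (t0 : ℕ) (g : GD d) (l : Fin d) (t : ℕ) (h : t ≠ t0) :
    flip l0 t0 g l t = g l t := by simp [flip, h]

lemma RR_flip (he : Adm e) (s : ℕ) (l0 : Fin d) (g : GD d) :
    RR e s (flip l0 (4 * KK s) g) = - RR e s g := by
  rw [RR_eq he, RR_eq he,
    QQ_congr he s (fun l t ht => flip_of_ne l0 (4 * KK s) g l t (by omega))]
  have : ∏ l, sg (flip l0 (4 * KK s) g l (4 * KK s)) = - ∏ l, sg (g l (4 * KK s)) := by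
    rw [← Finset.mul_prod_erase _ _ (Finset.mem_univ l0),
      ← Finset.mul_prod_erase Finset.univ (fun l => sg (g l (4 * KK s))) (Finset.mem_univ l0)]
    rw [Finset.prod_congr rfl (fun l hl => by
      rw [show flip l0 (4 * KK s) g l (4 * KK s) = g l (4 * KK s) by
        simp [flip, (Finset.mem_erase.1 hl).1]])]
    simp [flip, sg_add_one]
  rw [this]; ring

/-- successive corrections -/
def corr (e : ℕ → Fin d → ℕ → ℕ) (l0 : Fin d) (s : ℕ) (x : GD d) : ℕ → GD d
  | 0 => x
  | j + 1 => if RR e (s + j) (corr e l0 s x j) = 1 then corr e l0 s x j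
      else flip l0 (4 * KK (s + j)) (corr e l0 s x j)

lemma corr_RR (he : Adm e) (l0 : Fin d) (s : ℕ) (x : GD d) (j : ℕ) :
    RR e (s + j) (corr e l0 s x (j + 1)) = 1 := by
  simp only [corr]
  split_ifs with h
  · exact h
  · rw [RR_flip he, (RR_cases _ _).resolve_left h, neg_neg]

lemma corr_step (l0 : Fin d) (s : ℕ) (x : GD d) (j : ℕ) (l : Fin d) (t : ℕ)
    (ht : t ≠ 4 * KK (s + j)) : corr e l0 s x (j + 1) l t = corr e l0 s x j l t := by
  simp only [corr]
  split_ifs with h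
  · rfl
  · exact flip_of_ne _ _ _ _ _ ht

lemma corr_agree (l0 : Fin d) (s : ℕ) (x : GD d) (j i : ℕ) :
    Agree (4 * KK (s + j)) (corr e l0 s x (j + i)) (corr e l0 s x j) := by
  induction i with
  | zero => intro l t _; rfl
  | succ i ih =>
    intro l t ht
    have : KK (s + j) ≤ KK (s + (j + i)) := KK_mono.monotone (by omega)
    rw [← add_assoc, corr_step _ _ _ _ _ _ (by omega), ih l t ht]

lemma extend (he : Adm e) (hd : 0 < d) (s : ℕ) (x : GD d) (hx : ff e s x ≠ 0) :
    ∃ g, (∀ i, RR e i g = 1) ∧ Agree (4 * KK s) g x := by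
  let l0 : Fin d := ⟨0, hd⟩
  let y := corr e l0 s x
  let g : GD d := fun l t => y (t + 1) l t
  have hgx : Agree (4 * KK s) g x := by
    intro l t ht
    have := corr_agree (e := e) l0 s x 0 (t + 1) l t (by simpa using ht)
    rw [zero_add] at this
    exact this
  refine ⟨g, fun i => ?_, hgx⟩
  rcases lt_or_ge i s with hi | hi
  · rw [RR_congr he i (g' := x)]
    · exact (ff_ne_zero s x).1 hx i hi
    · intro l t ht
      have : KK (i + 1) ≤ KK s := KK_mono.monotone hi
      exact hgx l t (by omega)
  · obtain ⟨j, rfl⟩ := Nat.exists_eq_add_of_le hi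
    rw [RR_congr he (s + j) (g' := y (j + 1)), corr_RR he]
    intro l t ht
    change corr e l0 s x (t + 1) l t = corr e l0 s x (j + 1) l t
    rcases le_or_gt j t with h | h
    · obtain ⟨i, rfl⟩ := Nat.exists_eq_add_of_le h
      have := corr_agree (e := e) l0 s x (j + 1) i l (j + i) (by
        rw [← add_assoc]; omega)
      rw [show j + i + 1 = j + 1 + i by ring, this]
    · obtain ⟨i, rfl⟩ := Nat.exists_eq_add_of_lt h
      have h3 := KK_ge (s + (t + 1))
      have := corr_agree (e := e) l0 s x (t + 1) (i + 1) l t (by omega)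
      rw [show t + i + 1 + 1 = t + 1 + (i + 1) by ring, this]

lemma mem_Fspi (π : PermSeq d) (he : Adm e)
    (hπ : ∀ s m, π.p (s + 1) m = fun l => e s l (m l)) (s : ℕ) (g : GD d) :
    g ∈ Fspi π.f (s + 1) ↔ RR e s g = 1 := by
  have hW : walshD (fun _ => 2 ^ (2 * (2 * KK s))) g = ∏ l, sg (g l (4 * KK s)) := by
    unfold walshD
    apply Finset.prod_congr rfl
    intro l _
    rw [walsh_top, show 2 * (2 * KK s) = 4 * KK s by ring]; rfl
  have hV : ∀ p' : Fin d → ℕ, (∀ l, p' l = idx (2 * KK s) (sh (2 * KK s) (g l))) →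
      walshValD (2 * KK s) (fun l => e s l (idx (2 * KK s) (g l))) p' = QQ e s g := by
    intro p' hp'
    unfold walshValD walshD QQ
    apply Finset.prod_congr rfl
    intro l _
    apply walsh_congr (he s l _ (idx_lt _ _))
    intro t ht
    simp only [cubePoint]
    rw [hp' l, ip_idx _ _ t ht]
  have hfin : (∏ l, sg (g l (4 * KK s)) = QQ e s g) ↔ RR e s g = 1 := by
    rw [RR_eq he]
    have h1 : (∏ l, sg (g l (4 * KK s))) * ∏ l, sg (g l (4 * KK s)) = 1 := by
      rw [← Finset.prod_mul_distrib]
      exact Finset.prod_eq_one fun l _ => by unfold sg; split_ifs <;> norm_num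
    constructor
    · intro h; rw [← h, h1]
    · intro h
      calc ∏ l, sg (g l (4 * KK s)) = (QQ e s g * ∏ l, sg (g l (4 * KK s))) *
            ∏ l, sg (g l (4 * KK s)) := by rw [h, one_mul]
        _ = QQ e s g := by rw [mul_assoc, h1, mul_one]
  rw [← hfin, ← hW]
  simp only [Fspi, Set.mem_iUnion, Set.mem_ofPred_eq, mSeq_succ, PermSeq.f, hπ, exists_prop, _root_.box,
    dyadicCube]
  constructor
  · rintro ⟨p, hp, p', hp', hc, hw⟩
    have key : ∀ l, p l = idx (2 * KK s) (g l) ∧ p' l = idx (2 * KK s) (sh (2 * KK s) (g l)) := by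
      intro l
      have h := (mem_dyadicInterval_iff _ _ (by
        have h1 := hp l; have h2 := hp' l
        rw [two_mul (2 * KK s), pow_add]
        calc 2 ^ (2 * KK s) * p l + p' l < 2 ^ (2 * KK s) * p l + 2 ^ (2 * KK s) := by omega
          _ = 2 ^ (2 * KK s) * (p l + 1) := by ring
          _ ≤ _ := Nat.mul_le_mul_left _ h1) _).1 (hc l)
      rw [two_mul (2 * KK s), idx_add] at h
      have h2 := hp' l
      have h3 := idx_lt (2 * KK s) (sh (2 * KK s) (g l))
      have hpos : 0 < 2 ^ (2 * KK s) := by positivity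
      constructor
      · have := congrArg (· / 2 ^ (2 * KK s)) h
        simp only [Nat.mul_add_div hpos, Nat.div_eq_of_lt h2, Nat.div_eq_of_lt h3] at this
        omega
      · have := congrArg (· % 2 ^ (2 * KK s)) h
        simp only [Nat.mul_add_mod, Nat.mod_eq_of_lt h2, Nat.mod_eq_of_lt h3] at this
        omega
    rw [hw, ← hV p' (fun l => (key l).2)]
    congr 1
    funext l
    rw [(key l).1]
  · intro h
    refine ⟨fun l => idx (2 * KK s) (g l), fun l => idx_lt _ _,
      fun l => idx (2 * KK s) (sh (2 * KK s) (g l)), fun l => idx_lt _ _, fun l => ?_, ?_⟩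
    · have : 2 ^ (2 * KK s) * idx (2 * KK s) (g l) + idx (2 * KK s) (sh (2 * KK s) (g l))
          = idx (2 * (2 * KK s)) (g l) := by rw [two_mul (2 * KK s), idx_add]
      rw [this, mem_dyadicInterval_iff _ _ (idx_lt _ _)]
    · rw [h, hV _ (fun l => rfl)]

lemma mem_Fpi (π : PermSeq d) (he : Adm e)
    (hπ : ∀ s m, π.p (s + 1) m = fun l => e s l (m l)) (g : GD d) :
    g ∈ Fpi π.f ↔ ∀ s, RR e s g = 1 := by
  simp only [Fpi, Set.mem_iInter, Set.mem_Ici]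
  constructor
  · intro h s
    exact (mem_Fspi π he hπ s g).1 (h (s + 1) (by omega))
  · intro h s hs
    obtain ⟨j, rfl⟩ := Nat.exists_eq_add_of_le' hs
    exact (mem_Fspi π he hπ j g).2 (h j)

lemma agree_of_mem {k : ℕ} {m : Fin d → ℕ} {g : GD d} (h : g ∈ dyadicCube k m) :
    Agree k g (cubePoint k m) := by
  intro l t ht
  rw [h l t ht]
  exact (ip_mem k (m l) t ht).symm

lemma meets_iff (π : PermSeq d) (he : Adm e) (hd : 0 < d)
    (hπ : ∀ s m, π.p (s + 1) m = fun l => e s l (m l)) (s k : ℕ) (h1 : KK s ≤ k)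
    (h2 : k ≤ 4 * KK s) (m : Fin d → ℕ) :
    (dyadicCube k m ∩ Fpi π.f).Nonempty ↔ ff e s (cubePoint k m) ≠ 0 := by
  constructor
  · rintro ⟨g, hg, hF⟩
    rw [← ff_congr he s (fun l t ht => agree_of_mem hg l t (by omega)), ff_ne_zero]
    exact fun i _ => (mem_Fpi π he hπ g).1 hF i
  · intro h
    obtain ⟨g, hg, ha⟩ := extend he hd s _ h
    refine ⟨g, fun l t ht => ?_, (mem_Fpi π he hπ g).2 hg⟩
    rw [ha l t (by omega)]
    exact ip_mem k (m l) t ht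

end layers

section tau

variable {d : ℕ} {e : ℕ → Fin d → ℕ → ℕ}

lemma agree_child (k : ℕ) (m : Fin d → ℕ) (σ : Fin d → Fin 2) :
    Agree k (cubePoint (k + 1) fun l => 2 * m l + (σ l : ℕ)) (cubePoint k m) := by
  intro l t ht
  exact (ip_child k (m l) (σ l) (σ l).2).1 t ht

lemma sg_child (k : ℕ) (m : Fin d → ℕ) (σ : Fin d → Fin 2) (l : Fin d) :
    sg (cubePoint (k + 1) (fun l => 2 * m l + (σ l : ℕ)) l k) = if σ l = 0 then 1 else -1 := by
  have := (ip_child k (m l) (σ l) (σ l).2).2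
  simp only [cubePoint]
  rcases zmod2_cases (intervalPoint (k + 1) (2 * m l + (σ l : ℕ)) k) with h | h
  · rw [h] at this ⊢
    have h0 : σ l = 0 := by ext; simpa using this.symm
    simp [sg, h0]
  · rw [h] at this ⊢
    rw [ZMod.val_one] at this
    have h0 : σ l = 1 := by ext; simpa using this.symm
    simp [sg, h0]

lemma sum_signs (hd : 0 < d) :
    ∑ σ : Fin d → Fin 2, ∏ l, (if σ l = 0 then (1 : ℝ) else -1) = 0 := by
  have := Finset.prod_univ_sum (fun _ : Fin d => (Finset.univ : Finset (Fin 2)))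
    (fun _ b => if b = 0 then (1 : ℝ) else -1)
  rw [Fintype.piFinset_univ] at this
  rw [← this]
  apply Finset.prod_eq_zero (Finset.mem_univ ⟨0, hd⟩)
  simp [Fin.sum_univ_two]

lemma count_children (he : Adm e) (hd : 0 < d) (s : ℕ) (m : Fin d → ℕ) :
    ((Finset.univ.filter fun σ : Fin d → Fin 2 =>
      RR e s (cubePoint (4 * KK s + 1) fun l => 2 * m l + (σ l : ℕ)) = 1).card : ℝ)
      = 2 ^ d / 2 := by
  have h1 : ∀ σ : Fin d → Fin 2,
      (if RR e s (cubePoint (4 * KK s + 1) fun l => 2 * m l + (σ l : ℕ)) = 1 then (1 : ℝ) else 0)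
      = 1 / 2 + QQ e s (cubePoint (4 * KK s) m) / 2 * ∏ l, (if σ l = 0 then (1 : ℝ) else -1) := by
    intro σ
    have h2 : RR e s (cubePoint (4 * KK s + 1) fun l => 2 * m l + (σ l : ℕ))
        = QQ e s (cubePoint (4 * KK s) m) * ∏ l, (if σ l = 0 then (1 : ℝ) else -1) := by
      rw [RR_eq he, QQ_congr he s (agree_child _ m σ)]
      simp only [sg_child]
    rcases RR_cases (e := e) s (cubePoint (4 * KK s + 1) fun l => 2 * m l + (σ l : ℕ)) with h | h
    · rw [if_pos h]
      rw [h] at h2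
      linarith
    · rw [if_neg (by rw [h]; norm_num)]
      rw [h] at h2
      linarith
  rw [Finset.card_filter]
  push_cast
  rw [Finset.sum_congr rfl (fun σ _ => h1 σ), Finset.sum_add_distrib, ← Finset.mul_sum,
    sum_signs hd]
  simp [div_eq_mul_inv]

lemma tau_formula (π : PermSeq d) (he : Adm e) (hd : 0 < d)
    (hπ : ∀ s m, π.p (s + 1) m = fun l => e s l (m l))
    (τ : ℕ → (Fin d → ℕ) → ℂ) (hτ : IsTauOf (Fpi π.f) τ) (k : ℕ) :
    ∀ s, KK s ≤ k → k ≤ 4 * KK s → ∀ m : Fin d → ℕ, (∀ l, m l < 2 ^ k) →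
      τ k m = (((2 : ℝ) ^ (k * d))⁻¹ * ff e s (cubePoint k m) : ℝ) := by
  obtain ⟨-, h0, hz, hdiv⟩ := hτ
  induction k with
  | zero =>
    intro s h1 h2 m hm
    have hs : s = 0 := by have := KK_ge s; omega
    have hm0 : m = fun _ => 0 := by funext l; simpa using hm l
    subst hs
    rw [hm0, h0]
    simp [ff]
  | succ k ih =>
    intro s h1 h2 m hm
    -- parent and child
    obtain ⟨m', σ, rfl⟩ : ∃ (m' : Fin d → ℕ) (σ : Fin d → Fin 2),
        m = fun l => 2 * m' l + (σ l : ℕ) := by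
      refine ⟨fun l => m l / 2, fun l => ⟨m l % 2, Nat.mod_lt _ (by norm_num)⟩, ?_⟩
      funext l
      simp only
      omega
    have hm' : ∀ l, m' l < 2 ^ k := by
      intro l
      have := hm l
      simp only [pow_succ] at this
      omega
    have hzero : ∀ j, KK j ≤ k + 1 → k + 1 ≤ 4 * KK j →
        ff e j (cubePoint (k + 1) fun l => 2 * m' l + (σ l : ℕ)) = 0 →
        τ (k + 1) (fun l => 2 * m' l + (σ l : ℕ)) = 0 := by
      intro j hj1 hj2 hj
      rw [hz _ _ hm, ← Set.not_nonempty_iff_eq_empty, meets_iff π he hd hπ j _ hj1 hj2]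
      simpa using hj
    by_cases hff : ff e s (cubePoint (k + 1) fun l => 2 * m' l + (σ l : ℕ)) = 0
    · rw [hzero s h1 h2 hff, hff]; simp
    have hmeet := (meets_iff π he hd hπ s _ h1 h2 _).2 hff
    rcases Nat.lt_or_ge k (KK s) with hk | hk
    · -- special step
      obtain ⟨s, rfl⟩ : ∃ j, s = j + 1 := by
        cases s with
        | zero => simp [KK] at hk
        | succ j => exact ⟨j, rfl⟩
      have hk4 : k = 4 * KK s := by simp only [KK] at hk h1; omega
      subst hk4
      have hpar : ff e s (cubePoint (4 * KK s + 1) fun l => 2 * m' l + (σ l : ℕ))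
          = ff e s (cubePoint (4 * KK s) m') :=
        ff_congr he s (fun l t ht => agree_child _ m' σ l t (by omega))
      have hne : ff e s (cubePoint (4 * KK s) m') ≠ 0 := by
        rw [← hpar]
        intro h
        apply hff
        rw [ff_succ, h, zero_mul]
      have hR : RR e s (cubePoint (4 * KK s + 1) fun l => 2 * m' l + (σ l : ℕ)) = 1 :=
        (ff_ne_zero _ _).1 hff s (by omega)
      have hpm := (meets_iff π he hd hπ s (4 * KK s) (by omega) le_rfl m').2 hne
      rw [hdiv _ m' hm' hpm σ, if_pos hmeet, ih s (by omega) le_rfl m' hm']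
      have hcard : (Finset.univ.filter fun σ' : Fin d → Fin 2 =>
          (dyadicCube (4 * KK s + 1) (fun l => 2 * m' l + (σ' l : ℕ)) ∩ Fpi π.f).Nonempty)
          = Finset.univ.filter fun σ : Fin d → Fin 2 =>
            RR e s (cubePoint (4 * KK s + 1) fun l => 2 * m' l + (σ l : ℕ)) = 1 := by
        ext σ'
        simp only [Finset.mem_filter, Finset.mem_univ, true_and]
        rw [meets_iff π he hd hπ (s + 1) _ h1 h2]
        rw [ff_succ, ff_congr he s (fun l t ht => agree_child _ m' σ' l t (by omega))]
        rcases RR_cases (e := e) s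
          (cubePoint (4 * KK s + 1) fun l => 2 * m' l + (σ' l : ℕ)) with h | h
        · simp [h, hne]
        · rw [h]; norm_num
      rw [hcard]
      have hc := count_children he hd s m'
      rw [ff_succ, hR, hpar]
      have hc' : ((Finset.univ.filter fun σ : Fin d → Fin 2 =>
            RR e s (cubePoint (4 * KK s + 1) fun l => 2 * m' l + (σ l : ℕ)) = 1).card : ℂ)
          = (((2 : ℝ) ^ d / 2 : ℝ) : ℂ) := by
        rw [← hc]; push_cast; rfl
      rw [hc', ← Complex.ofReal_div]
      congr 1
      rw [add_mul, one_mul, pow_add]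
      field_simp
      norm_num
    · have hpar : ∀ σ' : Fin d → Fin 2,
          ff e s (cubePoint (k + 1) fun l => 2 * m' l + (σ' l : ℕ))
          = ff e s (cubePoint k m') := fun σ' =>
        ff_congr he s (fun l t ht => agree_child _ m' σ' l t (by omega))
      have hne : ff e s (cubePoint k m') ≠ 0 := by
        rw [← hpar σ]; exact hff
      have hpm := (meets_iff π he hd hπ s k hk (by omega) m').2 hne
      rw [hdiv _ m' hm' hpm σ, if_pos hmeet, ih s hk (by omega) m' hm']
      have hcard : (Finset.univ.filter fun σ' : Fin d → Fin 2 =>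
          (dyadicCube (k + 1) (fun l => 2 * m' l + (σ' l : ℕ)) ∩ Fpi π.f).Nonempty)
          = Finset.univ := by
        ext σ'
        simp only [Finset.mem_filter, Finset.mem_univ, true_and, iff_true]
        rw [meets_iff π he hd hπ s _ h1 h2, hpar]
        exact hne
      rw [hcard, hpar]
      have hc' : ((Finset.univ : Finset (Fin d → Fin 2)).card : ℂ) = (((2 : ℝ) ^ d : ℝ) : ℂ) := by
        simp
      rw [hc', ← Complex.ofReal_div]
      congr 1
      rw [add_mul, one_mul, pow_add]
      field_simp

/-! ### Orthogonality in `d` dimensions -/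

lemma mem_boxLt {N n : Fin d → ℕ} : n ∈ boxLt N ↔ ∀ l, n l < N l := by
  simp [boxLt]

lemma walshD_orth (k : ℕ) (n n' : Fin d → ℕ) (hn : ∀ l, n l < 2 ^ k) (hn' : ∀ l, n' l < 2 ^ k) :
    ∑ m ∈ boxLt (fun _ : Fin d => 2 ^ k), walshD n (cubePoint k m) * walshD n' (cubePoint k m)
      = if n = n' then (2 : ℝ) ^ (k * d) else 0 := by
  unfold boxLt walshD cubePoint
  simp only [← Finset.prod_mul_distrib]
  rw [← Finset.prod_univ_sum (fun _ : Fin d => Finset.range (2 ^ k))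
    (fun l x => walsh (n l) (intervalPoint k x) * walsh (n' l) (intervalPoint k x))]
  simp only [fun l => walsh_orth k _ _ (hn l) (hn' l)]
  split_ifs with h
  · subst h; simp [pow_mul]
  · obtain ⟨l, hl⟩ := Function.ne_iff.1 h
    exact Finset.prod_eq_zero (Finset.mem_univ l) (if_neg hl)

lemma fourier_of_expansion (τ : ℕ → (Fin d → ℕ) → ℂ) (k : ℕ) (b : (Fin d → ℕ) → ℂ)
    (h : ∀ m : Fin d → ℕ, (∀ l, m l < 2 ^ k) → τ k m = ((2 : ℂ) ^ (k * d))⁻¹ *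
      ∑ n ∈ boxLt (fun _ : Fin d => 2 ^ k), b n * (walshD n (cubePoint k m) : ℂ))
    (n : Fin d → ℕ) (hn : ∀ l, n l < 2 ^ k) : fourierCoeffAt τ n k = b n := by
  unfold fourierCoeffAt walshValD
  have h1 : ∀ m ∈ boxLt (fun _ : Fin d => 2 ^ k), (walshD n (cubePoint k m) : ℂ) * τ k m
      = ∑ n' ∈ boxLt (fun _ : Fin d => 2 ^ k), ((2 : ℂ) ^ (k * d))⁻¹ * b n' *
        ((walshD n (cubePoint k m) * walshD n' (cubePoint k m) : ℝ) : ℂ) := by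
    intro m hm
    rw [h m (mem_boxLt.1 hm), Finset.mul_sum, Finset.mul_sum]
    apply Finset.sum_congr rfl
    intro n' _
    push_cast; ring
  rw [Finset.sum_congr rfl h1, Finset.sum_comm]
  have h2 : ∀ n' ∈ boxLt (fun _ : Fin d => 2 ^ k),
      ∑ m ∈ boxLt (fun _ : Fin d => 2 ^ k), ((2 : ℂ) ^ (k * d))⁻¹ * b n' *
        ((walshD n (cubePoint k m) * walshD n' (cubePoint k m) : ℝ) : ℂ)
      = if n = n' then b n' else 0 := by
    intro n' hn'
    rw [← Finset.mul_sum, ← Complex.ofReal_sum, walshD_orth k n n' hn (mem_boxLt.1 hn')]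
    split_ifs
    · push_cast
      field_simp
    · simp
  rw [Finset.sum_congr rfl h2, Finset.sum_ite_eq, if_pos (mem_boxLt.2 hn)]

end tau

section blocks

/-- one-dimensional factor of the partial sums of a block -/
def GG (m N y x : ℕ) (g : DyadicGroup) : ℝ :=
  ∑ n ∈ Finset.range N,
    (if n / 2 ^ m = y then ((2 : ℝ) ^ m)⁻¹ * walsh (n % 2 ^ m) (intervalPoint m x) else 0) *
      walsh n g

lemma GG_eq (m N y x : ℕ) (g : DyadicGroup) :
    GG m N y x g = ((2 : ℝ) ^ m)⁻¹ * walsh y (sh m g) *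
      ∑ q ∈ Finset.range (min (2 ^ m) (N - 2 ^ m * y)),
        walsh q (intervalPoint m x) * walsh q g := by
  have hpos : 0 < 2 ^ m := by positivity
  unfold GG
  simp only [ite_mul, zero_mul]
  rw [← Finset.sum_filter, Finset.mul_sum]
  symm
  refine Finset.sum_nbij' (fun q => 2 ^ m * y + q) (fun n => n - 2 ^ m * y) ?_ ?_ ?_ ?_ ?_
  · intro q hq
    simp only [Finset.mem_range, lt_min_iff] at hq
    simp only [Finset.mem_filter, Finset.mem_range]
    refine ⟨by omega, ?_⟩
    rw [Nat.mul_add_div hpos, Nat.div_eq_of_lt hq.1, add_zero]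
  · intro n hn
    simp only [Finset.mem_filter, Finset.mem_range] at hn
    obtain ⟨h1, rfl⟩ := hn
    have h3 := Nat.div_add_mod n (2 ^ m)
    have h4 := Nat.mod_lt n hpos
    simp only [Finset.mem_range, lt_min_iff]
    generalize 2 ^ m * (n / 2 ^ m) = z at *
    omega
  · intro q _
    simp
  · intro n hn
    simp only [Finset.mem_filter, Finset.mem_range] at hn
    obtain ⟨h1, rfl⟩ := hn
    have := Nat.mul_div_le n (2 ^ m)
    omega
  · intro q hq
    simp only [Finset.mem_range, lt_min_iff] at hq
    rw [walsh_split _ _ _ hq.1, Nat.mul_add_mod, Nat.mod_eq_of_lt hq.1]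
    ring

lemma GG_full (m N y x : ℕ) (hx : x < 2 ^ m) (g : DyadicGroup) (h : 2 ^ m * y + 2 ^ m ≤ N) :
    GG m N y x g = if x = idx m g then walsh y (sh m g) else 0 := by
  rw [GG_eq, min_eq_left (by omega), walsh_kernel]
  have hiff : (∀ t < m, intervalPoint m x t = g t) ↔ x = idx m g := by
    constructor
    · intro H; rw [← idx_ip hx]; exact idx_congr m H
    · rintro rfl; exact ip_idx m g
  simp only [hiff]
  split_ifs
  · field_simp
  · simp

lemma GG_ne_zero (m N y x : ℕ) (hx : x < 2 ^ m) (g : DyadicGroup) (h : GG m N y x g ≠ 0) :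
    x = idx m g ∨ y = N / 2 ^ m := by
  by_contra hc
  push Not at hc
  apply h
  rcases le_or_gt (2 ^ m * y + 2 ^ m) N with h1 | h1
  · rw [GG_full m N y x hx g h1, if_neg hc.1]
  · rcases le_or_gt N (2 ^ m * y) with h2 | h2
    · rw [GG_eq, Nat.sub_eq_zero_of_le h2]; simp
    · exfalso
      apply hc.2
      symm
      apply Nat.div_eq_of_lt_le
      · rw [mul_comm]; exact h2.le
      · rw [mul_comm, mul_add, mul_one]; exact h1

lemma GG_le_one (m N y x : ℕ) (g : DyadicGroup) : |GG m N y x g| ≤ 1 := by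
  rw [GG_eq, abs_mul, abs_mul, walsh_abs, mul_one, abs_of_nonneg (by positivity)]
  have h1 := walsh_kernel_bound_triv (min (2 ^ m) (N - 2 ^ m * y)) (intervalPoint m x) g
  have h2 : ((min (2 ^ m) (N - 2 ^ m * y) : ℕ) : ℝ) ≤ 2 ^ m := by
    exact_mod_cast min_le_left _ _
  rw [inv_mul_le_iff₀ (by positivity), mul_one]
  exact h1.trans h2

lemma GG_small (m N y x j : ℕ) (g : DyadicGroup) (h : ∃ t < j, intervalPoint m x t ≠ g t) :
    |GG m N y x g| ≤ ((2 : ℝ) ^ m)⁻¹ * 2 ^ j := by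
  rw [GG_eq, abs_mul, abs_mul, walsh_abs, mul_one, abs_of_nonneg (by positivity)]
  exact mul_le_mul_of_nonneg_left (walsh_kernel_bound _ _ _ _ h) (by positivity)

variable {d : ℕ} {e : ℕ → Fin d → ℕ → ℕ}

/-- the coefficients of block `s+1` -/
def cc (e : ℕ → Fin d → ℕ → ℕ) (s : ℕ) (n : Fin d → ℕ) : ℝ :=
  ∑ p ∈ boxLt (fun _ : Fin d => 2 ^ (2 * KK s)), ff e s (cubePoint (2 * KK s) p) *
    ∏ l, (if n l / 2 ^ (2 * KK s) = 2 ^ (2 * KK s) + e s l (p l) then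
      ((2 : ℝ) ^ (2 * KK s))⁻¹ * walsh (n l % 2 ^ (2 * KK s)) (intervalPoint (2 * KK s) (p l))
      else 0)

lemma cc_supp (he : Adm e) (s : ℕ) (n : Fin d → ℕ) (h : cc e s n ≠ 0) (l : Fin d) :
    2 ^ (4 * KK s) ≤ n l ∧ n l < 2 ^ KK (s + 1) := by
  obtain ⟨p, hp, hne⟩ := Finset.exists_ne_zero_of_sum_ne_zero h
  have h2 := Finset.prod_ne_zero_iff.1 (right_ne_zero_of_mul hne) l (Finset.mem_univ l)
  have h3 : n l / 2 ^ (2 * KK s) = 2 ^ (2 * KK s) + e s l (p l) := by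
    by_contra hc
    exact h2 (if_neg hc)
  have h4 := he s l (p l) (mem_boxLt.1 hp l)
  have hpos : 0 < 2 ^ (2 * KK s) := by positivity
  have h5 := Nat.div_add_mod (n l) (2 ^ (2 * KK s))
  have h6 := Nat.mod_lt (n l) hpos
  have e1 : 2 ^ (4 * KK s) = 2 ^ (2 * KK s) * 2 ^ (2 * KK s) := by rw [← pow_add]; congr 1; ring
  have e2 : 2 ^ KK (s + 1) = 2 * (2 ^ (2 * KK s) * 2 ^ (2 * KK s)) := by
    rw [KK, pow_succ, e1]; ring
  rw [e1, e2]
  rw [h3] at h5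
  generalize 2 ^ (2 * KK s) = z at *
  constructor <;> nlinarith [Nat.zero_le (z * e s l (p l)), Nat.zero_le (n l % z)]

/-- rectangular partial sums of block `s+1` -/
def TT (e : ℕ → Fin d → ℕ → ℕ) (s : ℕ) (N : Fin d → ℕ) (g : GD d) : ℝ :=
  ∑ n ∈ boxLt N, cc e s n * walshD n g

lemma TT_eq (s : ℕ) (N : Fin d → ℕ) (g : GD d) :
    TT e s N g = ∑ p ∈ boxLt (fun _ : Fin d => 2 ^ (2 * KK s)),
      ff e s (cubePoint (2 * KK s) p) *
        ∏ l, GG (2 * KK s) (N l) (2 ^ (2 * KK s) + e s l (p l)) (p l) (g l) := by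
  unfold TT cc
  simp only [Finset.sum_mul]
  rw [Finset.sum_comm]
  apply Finset.sum_congr rfl
  intro p _
  unfold GG
  rw [Finset.prod_univ_sum, Finset.mul_sum]
  unfold boxLt walshD
  apply Finset.sum_congr rfl
  intro n _
  rw [mul_assoc, Finset.prod_mul_distrib]

lemma TT_full (he : Adm e) (s : ℕ) (N : Fin d → ℕ) (hN : ∀ l, 2 ^ KK (s + 1) ≤ N l) (g : GD d) :
    TT e s N g = ff e s g * RR e s g := by
  rw [TT_eq]
  have hG : ∀ p ∈ boxLt (fun _ : Fin d => 2 ^ (2 * KK s)), ∀ l,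
      GG (2 * KK s) (N l) (2 ^ (2 * KK s) + e s l (p l)) (p l) (g l)
      = if p l = idx (2 * KK s) (g l) then
        walsh (2 ^ (2 * KK s) + e s l (p l)) (sh (2 * KK s) (g l)) else 0 := by
    intro p hp l
    have h4 := he s l (p l) (mem_boxLt.1 hp l)
    apply GG_full _ _ _ _ (mem_boxLt.1 hp l)
    refine le_trans ?_ (hN l)
    have e2 : 2 ^ KK (s + 1) = 2 * (2 ^ (2 * KK s) * 2 ^ (2 * KK s)) := by
      rw [KK, pow_succ, ← pow_add]; ring
    rw [e2]
    generalize 2 ^ (2 * KK s) = z at *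
    nlinarith
  rw [Finset.sum_eq_single (fun l => idx (2 * KK s) (g l))]
  · rw [Finset.prod_congr rfl (fun l _ => hG _ (mem_boxLt.2 fun l => idx_lt _ _) l)]
    simp only [if_true]
    rw [ff_congr he s (g' := g)]
    · rfl
    · intro l t ht
      exact ip_idx _ _ t (by omega)
  · intro p hp hne
    obtain ⟨l, hl⟩ := Function.ne_iff.1 hne
    rw [Finset.prod_eq_zero (Finset.mem_univ l), mul_zero]
    rw [hG p hp l, if_neg hl]
  · intro h
    exact absurd (mem_boxLt.2 fun l => idx_lt _ _) h

lemma TT_bound (he : Adm e) (hinj : ∀ s l, Function.Injective (e s l)) (s : ℕ) (N : Fin d → ℕ)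
    (g : GD d) (hg : ff e s g = 0) :
    |TT e s N g| ≤ 2 ^ d * (2 ^ s * (((2 : ℝ) ^ (2 * KK s))⁻¹ * 2 ^ KK s)) := by
  classical
  rw [TT_eq]
  set G : Fin d → ℕ → ℝ := fun l x =>
    GG (2 * KK s) (N l) (2 ^ (2 * KK s) + e s l x) x (g l) with hG
  set P : Finset (Fin d → ℕ) := Fintype.piFinset fun l =>
    (Finset.range (2 ^ (2 * KK s))).filter fun x => G l x ≠ 0 with hP
  have hcard : (P.card : ℝ) ≤ 2 ^ d := by
    have : P.card ≤ 2 ^ d := by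
      rw [hP, Fintype.card_piFinset]
      calc _ ≤ ∏ _l : Fin d, 2 := by
            apply Finset.prod_le_prod'
            intro l _
            have hsub : ((Finset.range (2 ^ (2 * KK s))).filter fun x => G l x ≠ 0) ⊆
                {idx (2 * KK s) (g l)} ∪ (Finset.range (2 ^ (2 * KK s))).filter
                  fun x => 2 ^ (2 * KK s) + e s l x = N l / 2 ^ (2 * KK s) := by
              intro x hx
              rw [Finset.mem_filter, Finset.mem_range] at hx
              rw [Finset.mem_union, Finset.mem_singleton, Finset.mem_filter, Finset.mem_range]
              rcases GG_ne_zero _ _ _ _ hx.1 _ hx.2 with h | h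
              · exact Or.inl h
              · exact Or.inr ⟨hx.1, h⟩
            refine (Finset.card_le_card hsub).trans ((Finset.card_union_le _ _).trans ?_)
            have : ((Finset.range (2 ^ (2 * KK s))).filter
                  fun x => 2 ^ (2 * KK s) + e s l x = N l / 2 ^ (2 * KK s)).card ≤ 1 := by
              rw [Finset.card_le_one]
              intro a ha b hb
              have ha := (Finset.mem_filter.1 ha).2
              have hb := (Finset.mem_filter.1 hb).2
              exact hinj s l (by omega)
            simp only [Finset.card_singleton]
            omega
        _ = 2 ^ d := by simp
    exact_mod_cast this
  have hsub : P ⊆ boxLt (fun _ : Fin d => 2 ^ (2 * KK s)) := by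
    intro p hp
    rw [hP, Fintype.mem_piFinset] at hp
    exact mem_boxLt.2 fun l => Finset.mem_range.1 (Finset.mem_filter.1 (hp l)).1
  have hrestr : ∑ p ∈ boxLt (fun _ : Fin d => 2 ^ (2 * KK s)),
      ff e s (cubePoint (2 * KK s) p) * ∏ l, G l (p l)
      = ∑ p ∈ P, ff e s (cubePoint (2 * KK s) p) * ∏ l, G l (p l) := by
    symm
    apply Finset.sum_subset hsub
    intro p hp hnp
    have : ∃ l, G l (p l) = 0 := by
      by_contra hc
      push Not at hc
      apply hnp
      rw [hP, Fintype.mem_piFinset]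
      intro l
      exact Finset.mem_filter.2 ⟨Finset.mem_range.2 (mem_boxLt.1 hp l), hc l⟩
    obtain ⟨l, hl⟩ := this
    rw [Finset.prod_eq_zero (Finset.mem_univ l) hl, mul_zero]
  change |∑ p ∈ boxLt (fun _ : Fin d => 2 ^ (2 * KK s)),
      ff e s (cubePoint (2 * KK s) p) * ∏ l, G l (p l)| ≤ _
  rw [hrestr]
  refine (Finset.abs_sum_le_sum_abs _ _).trans ?_
  have hterm : ∀ p ∈ P, |ff e s (cubePoint (2 * KK s) p) * ∏ l, G l (p l)|
      ≤ 2 ^ s * (((2 : ℝ) ^ (2 * KK s))⁻¹ * 2 ^ KK s) := by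
    intro p _
    by_cases hz : ff e s (cubePoint (2 * KK s) p) = 0
    · rw [hz, zero_mul, abs_zero]; positivity
    · have hna : ¬ Agree (KK s) (cubePoint (2 * KK s) p) g := by
        intro H
        exact hz ((ff_congr he s H).trans hg)
      unfold Agree at hna
      push Not at hna
      obtain ⟨l0, t, ht, hne⟩ := hna
      rw [abs_mul, abs_of_nonneg (ff_nonneg _ _), Finset.abs_prod]
      apply mul_le_mul (ff_le _ _) _ (Finset.prod_nonneg fun l _ => abs_nonneg _) (by positivity)
      rw [← Finset.mul_prod_erase _ _ (Finset.mem_univ l0)]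
      have h1 : ∏ l ∈ Finset.univ.erase l0, |G l (p l)| ≤ 1 :=
        Finset.prod_le_one (fun l _ => abs_nonneg _) (fun l _ => GG_le_one _ _ _ _ _)
      have h2 : |G l0 (p l0)| ≤ ((2 : ℝ) ^ (2 * KK s))⁻¹ * 2 ^ KK s :=
        GG_small _ _ _ _ _ _ ⟨t, ht, hne⟩
      calc _ ≤ (((2 : ℝ) ^ (2 * KK s))⁻¹ * 2 ^ KK s) * 1 :=
            mul_le_mul h2 h1 (Finset.prod_nonneg fun l _ => abs_nonneg _) (by positivity)
        _ = _ := mul_one _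
  refine (Finset.sum_le_card_nsmul _ _ _ hterm).trans ?_
  rw [nsmul_eq_mul]
  exact mul_le_mul_of_nonneg_right hcard (by positivity)

end blocks

section main

variable {d : ℕ} {e : ℕ → Fin d → ℕ → ℕ}

lemma sum_box_restrict (a : (Fin d → ℕ) → ℂ) (M N : Fin d → ℕ) (h : ∀ l, M l ≤ N l) (g : GD d) :
    ∑ n ∈ boxLt N, (if n ∈ boxLt M then a n else 0) * (walshD n g : ℂ)
      = walshPartialSum a M g := by
  unfold walshPartialSum
  simp only [ite_mul, zero_mul]
  rw [← Finset.sum_filter]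
  congr 1
  ext n
  simp only [Finset.mem_filter, mem_boxLt]
  constructor
  · exact fun H => H.2
  · exact fun H => ⟨fun l => (H l).trans_le (h l), H⟩

lemma TT_cast (s : ℕ) (N : Fin d → ℕ) (g : GD d) :
    ∑ n ∈ boxLt N, (cc e s n : ℂ) * (walshD n g : ℂ) = (TT e s N g : ℂ) := by
  unfold TT
  push_cast
  rfl

lemma a_rec (π : PermSeq d) (he : Adm e) (hd : 0 < d)
    (hπ : ∀ s m, π.p (s + 1) m = fun l => e s l (m l))
    (τ : ℕ → (Fin d → ℕ) → ℂ) (hτ : IsTauOf (Fpi π.f) τ) (a : (Fin d → ℕ) → ℂ)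
    (ha : ∀ (n : Fin d → ℕ) (k : ℕ), (∀ l, n l < 2 ^ k) → a n = fourierCoeffAt τ n k)
    (s : ℕ) (hP : ∀ g, walshPartialSum a (fun _ => 2 ^ KK s) g = (ff e s g : ℂ)) :
    (∀ n : Fin d → ℕ, (∀ l, n l < 2 ^ KK (s + 1)) →
      a n = (if n ∈ boxLt (fun _ => 2 ^ KK s) then a n else 0) + (cc e s n : ℂ)) ∧
    ∀ g, walshPartialSum a (fun _ => 2 ^ KK (s + 1)) g = (ff e (s + 1) g : ℂ) := by
  have hmono : 2 ^ KK s ≤ 2 ^ KK (s + 1) :=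
    Nat.pow_le_pow_right (by norm_num) (KK_mono.monotone (by omega))
  have hexp : ∀ g : GD d, ∑ n ∈ boxLt (fun _ : Fin d => 2 ^ KK (s + 1)),
      ((if n ∈ boxLt (fun _ => 2 ^ KK s) then a n else 0) + (cc e s n : ℂ)) * (walshD n g : ℂ)
      = (ff e (s + 1) g : ℂ) := by
    intro g
    simp only [add_mul]
    rw [Finset.sum_add_distrib, sum_box_restrict _ _ _ (fun _ => hmono), hP, TT_cast,
      TT_full he s _ (fun _ => le_rfl), ff_succ]
    push_cast; ring
  have h1 : ∀ n : Fin d → ℕ, (∀ l, n l < 2 ^ KK (s + 1)) →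
      a n = (if n ∈ boxLt (fun _ => 2 ^ KK s) then a n else 0) + (cc e s n : ℂ) := by
    intro n hn
    refine (ha n _ hn).trans (fourier_of_expansion τ (KK (s + 1))
      (fun n => (if n ∈ boxLt (fun _ => 2 ^ KK s) then a n else 0) + (cc e s n : ℂ)) ?_ n hn)
    · intro m hm
      rw [hexp, tau_formula π he hd hπ τ hτ _ (s + 1) le_rfl (by omega) m hm]
      push_cast; rfl
  refine ⟨h1, fun g => ?_⟩
  rw [← hexp]
  unfold walshPartialSum
  apply Finset.sum_congr rfl
  intro n hn
  rw [← h1 n (mem_boxLt.1 hn)]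

lemma a_zero (τ : ℕ → (Fin d → ℕ) → ℂ) (E : Set (GD d)) (hτ : IsTauOf E τ) (a : (Fin d → ℕ) → ℂ)
    (ha : ∀ (n : Fin d → ℕ) (k : ℕ), (∀ l, n l < 2 ^ k) → a n = fourierCoeffAt τ n k) :
    a (fun _ => 0) = 1 := by
  rw [ha _ 0 (by simp)]
  have hb : boxLt (fun _ : Fin d => 2 ^ 0) = {fun _ => 0} := by
    ext n
    rw [mem_boxLt, Finset.mem_singleton, funext_iff]
    simp
  rw [fourierCoeffAt, hb, Finset.sum_singleton, hτ.2.1]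
  simp [walshValD, walshD, walsh_zero]

lemma a_all (π : PermSeq d) (he : Adm e) (hd : 0 < d)
    (hπ : ∀ s m, π.p (s + 1) m = fun l => e s l (m l))
    (τ : ℕ → (Fin d → ℕ) → ℂ) (hτ : IsTauOf (Fpi π.f) τ) (a : (Fin d → ℕ) → ℂ)
    (ha : ∀ (n : Fin d → ℕ) (k : ℕ), (∀ l, n l < 2 ^ k) → a n = fourierCoeffAt τ n k) (s : ℕ) :
    ∀ g, walshPartialSum a (fun _ => 2 ^ KK s) g = (ff e s g : ℂ) := by
  induction s with
  | zero =>
    intro g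
    have hb : boxLt (fun _ : Fin d => 2 ^ KK 0) = {fun _ => 0} := by
      ext n
      rw [mem_boxLt, Finset.mem_singleton, funext_iff]
      simp [KK]
    rw [walshPartialSum, hb, Finset.sum_singleton, a_zero τ _ hτ a ha]
    simp [walshD, walsh_zero, ff]
  | succ s ih => exact (a_rec π he hd hπ τ hτ a ha s ih).2

/-- the structural facts about the coefficients used below -/
structure Good (e : ℕ → Fin d → ℕ → ℕ) (a : (Fin d → ℕ) → ℂ) : Prop where
  sums : ∀ s g, walshPartialSum a (fun _ => 2 ^ KK s) g = (ff e s g : ℂ)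
  step : ∀ s n, (∀ l, n l < 2 ^ KK (s + 1)) →
      a n = (if n ∈ boxLt (fun _ => 2 ^ KK s) then a n else 0) + (cc e s n : ℂ)

lemma Good.supp {a : (Fin d → ℕ) → ℂ} (H : Good e a) (he : Adm e) (n : Fin d → ℕ) (hn : a n ≠ 0) :
    (∀ l, n l = 0) ∨ ∃ u, ∀ l, 2 ^ (4 * KK u) ≤ n l ∧ n l < 2 ^ KK (u + 1) := by
  have key : ∀ s, (∀ l, n l < 2 ^ KK s) →
      (∀ l, n l = 0) ∨ ∃ u, ∀ l, 2 ^ (4 * KK u) ≤ n l ∧ n l < 2 ^ KK (u + 1) := by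
    intro s
    induction s with
    | zero => intro h; left; simpa [KK] using h
    | succ s ih =>
      intro h
      by_cases hs : n ∈ boxLt (fun _ => 2 ^ KK s)
      · exact ih (mem_boxLt.1 hs)
      · right
        have h2 := H.step s n h
        rw [if_neg hs, zero_add] at h2
        refine ⟨s, fun l => cc_supp he s n ?_ l⟩
        intro h3
        apply hn
        rw [h2, h3]; simp
  apply key (∑ l, n l)
  intro l
  have h1 : n l ≤ ∑ l, n l := Finset.single_le_sum (fun _ _ => Nat.zero_le _) (Finset.mem_univ l)
  have h2 := KK_ge (∑ l, n l)
  exact lt_of_lt_of_le Nat.lt_two_pow_self (Nat.pow_le_pow_right (by norm_num) (h1.trans h2))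

lemma Good.supp_two {a : (Fin d → ℕ) → ℂ} (H : Good e a) (he : Adm e) (n : Fin d → ℕ)
    (hn : a n ≠ 0) (i j : Fin d) : n i ≤ 2 * n j := by
  rcases H.supp he n hn with h | ⟨u, h⟩
  · rw [h i]; omega
  · have h1 := h i
    have h2 := h j
    rw [KK, pow_succ] at h1
    omega

lemma Good.supp_box {a : (Fin d → ℕ) → ℂ} (H : Good e a) (he : Adm e) (n : Fin d → ℕ)
    (hn : a n ≠ 0) (s : ℕ) (j : Fin d) (hj : n j < 2 ^ KK s) (i : Fin d) : n i < 2 ^ KK s := by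
  rcases H.supp he n hn with h | ⟨u, h⟩
  · rw [h i]; positivity
  · have h1 := (h j).1.trans_lt hj
    have h2 : 4 * KK u < KK s := (Nat.pow_lt_pow_iff_right (by norm_num)).1 h1
    refine (h i).2.trans_le (Nat.pow_le_pow_right (by norm_num) ?_)
    rw [KK]; omega

lemma Good.partial_eq {a : (Fin d → ℕ) → ℂ} (H : Good e a) (he : Adm e) (t : ℕ) (N : Fin d → ℕ)
    (h1 : ∀ l, 2 ^ KK t ≤ N l) (j : Fin d) (h2 : N j < 2 ^ KK (t + 1)) (g : GD d) :
    walshPartialSum a N g = (ff e t g : ℂ) + (TT e t N g : ℂ) := by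
  have hmono : 2 ^ KK t ≤ 2 ^ KK (t + 1) :=
    Nat.pow_le_pow_right (by norm_num) (KK_mono.monotone (by omega))
  rw [← H.sums, ← sum_box_restrict a _ N h1, ← TT_cast, ← Finset.sum_add_distrib]
  unfold walshPartialSum
  apply Finset.sum_congr rfl
  intro n hn
  rw [← add_mul]
  congr 1
  have hn := mem_boxLt.1 hn
  by_cases hb : ∀ l, n l < 2 ^ KK (t + 1)
  · exact H.step t n hb
  · have ha : a n = 0 := by
      by_contra hc
      exact hb (H.supp_box he n hc (t + 1) j ((hn j).trans h2))
    have hcc : cc e t n = 0 := by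
      by_contra hc
      exact hb fun l => (cc_supp he t n hc l).2
    rw [ha, hcc]; simp

lemma Good.rect {a : (Fin d → ℕ) → ℂ} (H : Good e a) (he : Adm e) (hd : 0 < d)
    (hinj : ∀ s l, Function.Injective (e s l)) (g : GD d) (hg : ∃ s, RR e s g ≠ 1) :
    ConvergesOverRectangles a g 0 := by
  obtain ⟨s0, hs0⟩ := hg
  have hff : ∀ t, s0 < t → ff e t g = 0 := by
    intro t ht
    by_contra hc
    exact hs0 ((ff_ne_zero t g).1 hc s0 ht)
  unfold ConvergesOverRectangles
  rw [Metric.tendsto_atTop]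
  intro ε hε
  -- choose the rank
  obtain ⟨r, hr⟩ : ∃ r : ℕ, (2 : ℝ) ^ (d + 1) * (1 / 2) ^ r < ε := by
    obtain ⟨r, hr⟩ := exists_pow_lt_of_lt_one (show (0 : ℝ) < ε / 2 ^ (d + 1) by positivity)
      (show (1 / 2 : ℝ) < 1 by norm_num)
    refine ⟨r, ?_⟩
    rw [lt_div_iff₀ (by positivity)] at hr
    linarith
  let s1 := max (s0 + 1) r
  refine ⟨fun _ => 2 ^ KK s1, fun N hN => ?_⟩
  have hN : ∀ l, 2 ^ KK s1 ≤ N l := fun l => hN l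
  have hex : ∃ t, ∃ l, N l < 2 ^ KK t := by
    refine ⟨N ⟨0, hd⟩, ⟨0, hd⟩, ?_⟩
    exact lt_of_lt_of_le Nat.lt_two_pow_self (Nat.pow_le_pow_right (by norm_num) (KK_ge _))
  classical
  obtain ⟨j, hj⟩ := Nat.find_spec hex
  have hmin : ∀ t < Nat.find hex, ∀ l, 2 ^ KK t ≤ N l := by
    intro t ht l
    have := Nat.find_min hex ht
    push Not at this
    exact this l
  have hlt : s1 < Nat.find hex := by
    by_contra hc
    push Not at hc
    have h1 : 2 ^ KK (Nat.find hex) ≤ 2 ^ KK s1 :=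
      Nat.pow_le_pow_right (by norm_num) (KK_mono.monotone hc)
    have := hN j
    omega
  obtain ⟨t, ht⟩ : ∃ t, Nat.find hex = t + 1 := ⟨Nat.find hex - 1, by omega⟩
  rw [ht] at hj hmin hlt
  have ht0 : s0 < t := by have : s0 + 1 ≤ s1 := le_max_left _ _; omega
  have htr : r ≤ t := by have : r ≤ s1 := le_max_right _ _; omega
  rw [H.partial_eq he t N (hmin t (by omega)) j hj g, hff t ht0, dist_zero_right]
  simp only [Complex.ofReal_zero, zero_add, Complex.norm_real, Real.norm_eq_abs]
  refine lt_of_le_of_lt (TT_bound he hinj t N g (hff t ht0)) (lt_of_le_of_lt ?_ hr)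
  have hK := KK_ge' t
  have e1 : ((2 : ℝ) ^ (2 * KK t))⁻¹ * 2 ^ KK t = (2 ^ KK t)⁻¹ := by
    rw [two_mul, pow_add]; field_simp
  have e2 : (2 : ℝ) ^ t * (2 ^ KK t)⁻¹ ≤ 2 * (1 / 2) ^ t := by
    rw [one_div, inv_pow, ← div_eq_mul_inv, ← div_eq_mul_inv, div_le_div_iff₀ (by positivity)
      (by positivity), ← pow_add, mul_comm, ← pow_succ]
    exact pow_le_pow_right₀ (by norm_num) (by omega)
  have e3 : (1 / 2 : ℝ) ^ t ≤ (1 / 2) ^ r :=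
    pow_le_pow_of_le_one (by norm_num) (by norm_num) htr
  rw [e1, pow_succ, mul_assoc]
  exact mul_le_mul_of_nonneg_left (by linarith) (by positivity)

lemma rect_cubes {a : (Fin d → ℕ) → ℂ} {g : GD d} (h : ConvergesOverRectangles a g 0) :
    ConvergesOverCubes a g 0 := by
  unfold ConvergesOverRectangles at h
  unfold ConvergesOverCubes
  refine h.comp (tendsto_atTop.2 fun M => ?_)
  filter_upwards [eventually_ge_atTop (∑ l, M l)] with N hN l
  exact (Finset.single_le_sum (fun _ _ => Nat.zero_le _) (Finset.mem_univ l)).trans hN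

/-! ### Iterated summation -/

lemma sum_pi_update (F : Fin d → Finset ℕ) (j : Fin d) (x : ℕ) (hF : F j = {x}) (s : Finset ℕ)
    (f : (Fin d → ℕ) → ℂ) :
    ∑ k ∈ Fintype.piFinset (Function.update F j s), f k
      = ∑ k ∈ Fintype.piFinset F, ∑ t ∈ s, f (Function.update k j t) := by
  rw [← Finset.sum_product']
  refine Finset.sum_bij' (fun k _ => (Function.update k j x, k j))
    (fun p _ => Function.update p.1 j p.2) ?_ ?_ ?_ ?_ ?_
  · intro k hk
    rw [Fintype.mem_piFinset] at hk
    rw [Finset.mem_product, Fintype.mem_piFinset]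
    refine ⟨fun i => ?_, by simpa using hk j⟩
    by_cases hi : i = j
    · subst hi; simp [hF]
    · simpa [hi] using hk i
  · rintro ⟨k, t⟩ hp
    rw [Finset.mem_product, Fintype.mem_piFinset] at hp
    rw [Fintype.mem_piFinset]
    intro i
    by_cases hi : i = j
    · subst hi; simpa using hp.2
    · simpa [hi] using hp.1 i
  · intro k _
    simp
  · rintro ⟨k, t⟩ hp
    rw [Finset.mem_product, Fintype.mem_piFinset] at hp
    have := hp.1 j
    rw [hF, Finset.mem_singleton] at this
    simp only at this
    simp [← this]
  · intro k _
    simp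

/-- the box used for the iterated sums -/
def iterBox (l : List (Fin d)) (j0 : Fin d) (n : Fin d → ℕ) (T : ℕ) : Fin d → Finset ℕ :=
  fun i => if i = j0 then Finset.range T else if i ∈ l then Finset.range (2 * T) else {n i}

lemma iter_aux (j0 : Fin d) (l : List (Fin d)) (hl : l.Nodup) (hj : j0 ∉ l)
    (f : (Fin d → ℕ) → ℂ) (hf : ∀ n, f n ≠ 0 → ∀ i ∈ l, n i ≤ 2 * n j0)
    (h : ∀ n, Tendsto (fun T => ∑ k ∈ Fintype.piFinset (iterBox l j0 n T), f k) atTop (𝓝 0)) :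
    IterConvAux (l ++ [j0]) f (fun _ => 0) := by
  induction l generalizing f with
  | nil =>
    refine ⟨fun _ => 0, fun n => ?_, rfl⟩
    refine (h n).congr fun T => ?_
    have : iterBox [] j0 n T = Function.update (fun i => {n i}) j0 (Finset.range T) := by
      funext i
      by_cases hi : i = j0
      · subst hi; simp [iterBox]
      · simp [iterBox, hi]
    rw [this, sum_pi_update (fun i => {n i}) j0 (n j0) rfl]
    have h1 : Fintype.piFinset (fun i => ({n i} : Finset ℕ)) = {n} := by
      ext k
      simp [funext_iff]
    rw [h1, Finset.sum_singleton]
  | cons j rest ih =>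
    rw [List.nodup_cons] at hl
    have hjj : j ≠ j0 := fun H => hj (by simp [H])
    have hjr : j0 ∉ rest := fun H => hj (by simp [H])
    have hzero : ∀ n t, 2 * n j0 < t → f (Function.update n j t) = 0 := by
      intro n t ht
      by_contra hc
      have := hf _ hc j (by simp)
      rw [Function.update_self, Function.update_of_ne hjj.symm] at this
      omega
    refine ⟨fun n => ∑ t ∈ Finset.range (2 * n j0 + 1), f (Function.update n j t), fun n => ?_, ?_⟩
    · apply tendsto_const_nhds.congr'
      filter_upwards [eventually_ge_atTop (2 * n j0 + 1)] with T hT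
      apply Finset.sum_subset
      · intro t ht; simp only [Finset.mem_range] at *; omega
      · intro t _ ht
        simp only [Finset.mem_range, not_lt] at ht
        exact hzero n t (by omega)
    · apply ih hl.2 hjr
      · intro n hn i hi
        obtain ⟨t, _, ht⟩ := Finset.exists_ne_zero_of_sum_ne_zero hn
        have := hf _ ht i (by simp [hi])
        rw [Function.update_of_ne hjj.symm, Function.update_of_ne (by rintro rfl; exact hl.1 hi)]
          at this
        exact this
      · intro n
        refine (h n).congr fun T => ?_
        have e1 : iterBox (j :: rest) j0 n T
            = Function.update (iterBox rest j0 n T) j (Finset.range (2 * T)) := by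
          funext i
          by_cases hi : i = j
          · subst hi; simp [iterBox, hjj]
          · simp [iterBox, hi]
        rw [e1, sum_pi_update _ j (n j) (by simp [iterBox, hjj, hl.1])]
        apply Finset.sum_congr rfl
        intro k hk
        have hk0 : k j0 < T := by
          have := Fintype.mem_piFinset.1 hk j0
          simpa [iterBox] using this
        symm
        apply Finset.sum_subset
        · intro t ht; simp only [Finset.mem_range] at *; omega
        · intro t _ ht
          simp only [Finset.mem_range, not_lt] at ht
          exact hzero k t (by omega)

lemma rect_iter {a : (Fin d → ℕ) → ℂ} {g : GD d} (hd : 0 < d)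
    (hs : ∀ n, a n ≠ 0 → ∀ i j, n i ≤ 2 * n j)
    (h : ConvergesOverRectangles a g 0) (l : List (Fin d)) (hl : l.Nodup) (hmem : ∀ j, j ∈ l) :
    IterConverges l (fun n => a n * (walshD n g : ℂ)) 0 := by
  refine ⟨fun _ => 0, ?_, fun _ => rfl⟩
  have hne : l ≠ [] := List.ne_nil_of_mem (hmem ⟨0, hd⟩)
  obtain ⟨l', j0, rfl⟩ : ∃ l' j0, l = l' ++ [j0] :=
    ⟨l.dropLast, l.getLast hne, (List.dropLast_append_getLast hne).symm⟩
  have hl' : l'.Nodup ∧ j0 ∉ l' := by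
    rw [List.nodup_append] at hl
    refine ⟨hl.1, fun H => hl.2.2 j0 H j0 (by simp) rfl⟩
  apply iter_aux j0 l' hl'.1 hl'.2
  · intro n hn i _
    exact hs n (left_ne_zero_of_mul hn) i j0
  · intro n
    have hT : Tendsto (fun T : ℕ => fun i : Fin d => if i = j0 then T else 2 * T) atTop atTop := by
      refine tendsto_atTop.2 fun M => ?_
      filter_upwards [eventually_ge_atTop (∑ l, M l)] with N hN i
      have := (Finset.single_le_sum (fun _ _ => Nat.zero_le _) (Finset.mem_univ i)).trans hN
      dsimp only
      split_ifs <;> omega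
    refine (h.comp hT).congr fun T => ?_
    simp only [Function.comp, walshPartialSum, boxLt]
    congr 2
    funext i
    by_cases hi : i = j0
    · simp [iterBox, hi]
    · have : i ∈ l' := by
        have := hmem i
        simpa [hi] using this
      simp [iterBox, hi, this]

lemma exists_e (π : PermSeq d) (hπ : π.Coordinatewise) :
    ∃ e : ℕ → Fin d → ℕ → ℕ, Adm e ∧ (∀ s l, Function.Injective (e s l)) ∧
      ∀ s m, π.p (s + 1) m = fun l => e s l (m l) := by
  choose E hE using hπ
  refine ⟨fun s => E (s + 1), ?_, ?_, fun s m => hE (s + 1) m⟩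
  · intro s l x hx
    have := π.maps (s + 1) (x := fun _ => x) (by
      intro l'
      rw [mSeq_succ]; exact hx)
    have := this l
    rw [hE, mSeq_succ] at this
    exact this
  · intro s l x y hxy
    have : π.p (s + 1) (Function.update (fun _ => 0) l x)
        = π.p (s + 1) (Function.update (fun _ => 0) l y) := by
      rw [hE, hE]
      funext i
      by_cases hi : i = l
      · subst hi; simpa using hxy
      · simp [hi]
    have := congrFun ((π.p (s + 1)).injective this) l
    simpa using this

end main

end Aux15

/-- for `π ∈ S'`, the Walsh series whose coefficients are the Fourier–Walsh
coefficients of `τ_{F^π}` is a null-series realizing `F^π`, so `F^π` is an M-set for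
rectangular, cube and iterated convergence. -/
theorem statement15 (d : ℕ) (hd : 2 ≤ d) (π : PermSeq d) (hπ : π.Coordinatewise)
    (τ : ℕ → (Fin d → ℕ) → ℂ) (hτ : IsTauOf (Fpi π.f) τ) (a : (Fin d → ℕ) → ℂ)
    (ha : ∀ (n : Fin d → ℕ) (k : ℕ), (∀ l, n l < 2 ^ k) → a n = fourierCoeffAt τ n k) :
    a (fun _ => 0) = 1 ∧ (∃ n, a n ≠ 0) ∧
    (∀ g ∉ Fpi π.f,
      ConvergesOverRectangles a g 0 ∧ ConvergesOverCubes a g 0 ∧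
      ∀ l : List (Fin d), l.Nodup → (∀ j, j ∈ l) →
        IterConverges l (fun n => a n * (walshD n g : ℂ)) 0) ∧
    IsMSetRect (Fpi π.f) ∧ IsMSetCubes (Fpi π.f) ∧
    (∀ l : List (Fin d), l.Nodup → (∀ j, j ∈ l) → IsMSetIter (Fpi π.f) l) := by
  have hd0 : 0 < d := by omega
  obtain ⟨e, he, hinj, hp⟩ := Aux15.exists_e π hπ
  have hsum := Aux15.a_all π he hd0 hp τ hτ a ha
  have H : Aux15.Good e a :=
    ⟨hsum, fun s n hn => (Aux15.a_rec π he hd0 hp τ hτ a ha s (hsum s)).1 n hn⟩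
  have h0 : a (fun _ => 0) = 1 := Aux15.a_zero τ _ hτ a ha
  have hne : ∃ n, a n ≠ 0 := ⟨fun _ => 0, by rw [h0]; exact one_ne_zero⟩
  have hrect : ∀ g ∉ Fpi π.f, ConvergesOverRectangles a g 0 := by
    intro g hg
    apply H.rect he hd0 hinj g
    by_contra hc
    push Not at hc
    exact hg ((Aux15.mem_Fpi π he hp g).2 hc)
  have hiter : ∀ g ∉ Fpi π.f, ∀ l : List (Fin d), l.Nodup → (∀ j, j ∈ l) →
      IterConverges l (fun n => a n * (walshD n g : ℂ)) 0 := fun g hg l hl hm =>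
    Aux15.rect_iter hd0 (fun n hn i j => H.supp_two he n hn i j) (hrect g hg) l hl hm
  exact ⟨h0, hne, fun g hg => ⟨hrect g hg, Aux15.rect_cubes (hrect g hg), hiter g hg⟩,
    ⟨a, hne, hrect⟩, ⟨a, hne, fun g hg => Aux15.rect_cubes (hrect g hg)⟩,
    fun l hl hm => ⟨a, hne, fun g hg => hiter g hg l hl hm⟩⟩
end
end

section
/- Let τ = τ_F with Fourier–Walsh coefficients τ̂_𝐧, and let (ψ_𝐧)_{𝐧∈ℕ₀^d} ⊆ ℂ satisfy: (i) the d-multiple Walsh series with coefficients ψ_𝐧 converges to 0 over cubes at every point of 𝔾^d ∖ F; (ii) ψ_𝐧 = o(τ̂_𝐧) as max_j n^j → ∞, i.e., for every ε > 0 there exists K such that |ψ_𝐧| ≤ ε·|τ̂_𝐧| whenever max_j n^j ≥ K. Then ψ_𝐧 = 0 for all 𝐧 ∈ ℕ₀^d. -/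
open Filter Finset Topology MeasureTheory
open scoped Classical

noncomputable section

/-! ### Walsh values on cubes -/

lemma walsh_eq {k n : ℕ} (h : n < 2 ^ k) (g : DyadicGroup) :
    walsh n g = ∏ t ∈ range k, if n.testBit t ∧ g t = 1 then (-1 : ℝ) else 1 := by
  unfold walsh
  rw [Finset.prod_subset (s₂ := range (max n k)) (s₁ := range k),
    Finset.prod_subset (s₂ := range (max n k)) (s₁ := range n)]
  · intro t; simp only [Finset.mem_range]; omega
  · intro t _ ht
    have ht : n ≤ t := by simpa using ht
    have : n.testBit t = false := Nat.testBit_lt_two_pow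
      (lt_of_lt_of_le Nat.lt_two_pow_self (Nat.pow_le_pow_right (by norm_num) ht))
    simp [this]
  · intro t; simp only [Finset.mem_range]; omega
  · intro t _ ht
    have ht : k ≤ t := by simpa using ht
    have : n.testBit t = false := Nat.testBit_lt_two_pow
      (lt_of_lt_of_le h (Nat.pow_le_pow_right (by norm_num) ht))
    simp [this]

/-- explicit product for the Walsh matrix. -/
def wP (k n m : ℕ) : ℝ :=
  ∏ t ∈ range k, if n.testBit t ∧ m.testBit (k - 1 - t) then (-1 : ℝ) else 1

lemma wP_symm (k n m : ℕ) : wP k n m = wP k m n := by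
  unfold wP
  rw [← Finset.prod_range_reflect]
  refine Finset.prod_congr rfl fun t ht => ?_
  have ht : t < k := by simpa using ht
  have : k - 1 - (k - 1 - t) = t := by omega
  rw [this]
  simp only [and_comm]

lemma walshVal_eq {k n : ℕ} (h : n < 2 ^ k) (m : ℕ) : walshVal k n m = wP k n m := by
  unfold walshVal wP
  rw [walsh_eq h]
  refine Finset.prod_congr rfl fun t ht => ?_
  have ht : t < k := by simpa using ht
  simp [intervalPoint, ht]

/-- last factor. -/
def eps (k n : ℕ) (s : Fin 2) : ℝ := if n.testBit k ∧ s = 1 then -1 else 1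

lemma wP_child (k n m : ℕ) (s : Fin 2) :
    wP (k + 1) n (2 * m + (s : ℕ)) = wP k n m * eps k n s := by
  unfold wP eps
  rw [Finset.prod_range_succ]
  congr 1
  · refine Finset.prod_congr rfl fun t ht => ?_
    have ht : t < k := by simpa using ht
    have : k + 1 - 1 - t = (k - 1 - t) + 1 := by omega
    rw [this, Nat.testBit_add_one]
    have : (2 * m + (s : ℕ)) / 2 = m := by omega
    rw [this]
  · fin_cases s <;> simp [Nat.testBit_zero]

lemma eps_add (k n : ℕ) (s r : Fin 2) : eps k n (s + r) = eps k n s * eps k n r := by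
  unfold eps
  by_cases h : n.testBit k = true <;> fin_cases s <;> fin_cases r <;> simp [h]

lemma eps_lt {k n : ℕ} (h : n < 2 ^ k) (s : Fin 2) : eps k n s = 1 := by
  simp [eps, Nat.testBit_lt_two_pow h]

lemma wP_orth (k : ℕ) : ∀ m m' : ℕ, m < 2 ^ k → m' < 2 ^ k →
    ∑ n ∈ range (2 ^ k), wP k n m * wP k n m' = if m = m' then (2 : ℝ) ^ k else 0 := by
  induction k with
  | zero =>
    intro m m' h h'
    have : m = 0 := by simpa using h
    have : m' = 0 := by simpa using h'
    subst m; subst m'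
    simp [wP]
  | succ k ih =>
    intro m m' h h'
    obtain ⟨a, s, rfl⟩ : ∃ a, ∃ s : Fin 2, m = 2 * a + (s : ℕ) :=
      ⟨m / 2, ⟨m % 2, by omega⟩, by simp; omega⟩
    obtain ⟨a', s', rfl⟩ : ∃ a, ∃ s : Fin 2, m' = 2 * a + (s : ℕ) :=
      ⟨m' / 2, ⟨m' % 2, by omega⟩, by simp; omega⟩
    have ha : a < 2 ^ k := by rw [pow_succ] at h; omega
    have ha' : a' < 2 ^ k := by rw [pow_succ] at h'; omega
    have key : ∀ n b, wP k (2 ^ k + n) b = wP k n b := by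
      intro n b
      unfold wP
      refine Finset.prod_congr rfl fun t ht => ?_
      have ht : t < k := by simpa using ht
      rw [Nat.testBit_two_pow_add_gt ht]
    have h2 : (2 : ℕ) ^ (k + 1) = 2 ^ k + 2 ^ k := by ring
    rw [h2, Finset.sum_range_add]
    simp only [wP_child, key]
    have e1 : ∑ n ∈ range (2 ^ k), wP k n a * eps k n s * (wP k n a' * eps k n s')
        = ∑ n ∈ range (2 ^ k), wP k n a * wP k n a' := by
      refine Finset.sum_congr rfl fun n hn => ?_
      have hn : n < 2 ^ k := by simpa using hn
      simp [eps_lt hn]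
    have e2 : ∑ n ∈ range (2 ^ k), wP k n a * eps k (2 ^ k + n) s *
          (wP k n a' * eps k (2 ^ k + n) s')
        = (if s = s' then 1 else -1) * ∑ n ∈ range (2 ^ k), wP k n a * wP k n a' := by
      rw [Finset.mul_sum]
      refine Finset.sum_congr rfl fun n hn => ?_
      have hn : n < 2 ^ k := by simpa using hn
      have hb : (2 ^ k + n).testBit k = true := by
        rw [Nat.testBit_two_pow_add_eq, Nat.testBit_lt_two_pow hn]; rfl
      unfold eps
      rw [hb]
      fin_cases s <;> fin_cases s' <;> simp
    rw [e1, e2, ih a a' ha ha']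
    by_cases haa : a = a'
    · subst haa
      by_cases hs : s = s'
      · subst hs; simp; ring
      · have : (s : ℕ) ≠ s' := fun h => hs (Fin.ext h)
        simp [hs, this]
    · have : 2 * a + (s : ℕ) ≠ 2 * a' + (s' : ℕ) := by omega
      simp [haa, this]

/-- d-dimensional explicit Walsh matrix. -/
def wPD {d : ℕ} (k : ℕ) (n m : Fin d → ℕ) : ℝ := ∏ l, wP k (n l) (m l)

/-- index of a subcube. -/
def child {d : ℕ} (m : Fin d → ℕ) (σ : Fin d → Fin 2) : Fin d → ℕ :=
  fun l => 2 * m l + (σ l : ℕ)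

/-- character. -/
def chi {d : ℕ} (k : ℕ) (n : Fin d → ℕ) (σ : Fin d → Fin 2) : ℝ := ∏ l, eps k (n l) (σ l)

/-- the standard box. -/
def bx (d k : ℕ) : Finset (Fin d → ℕ) := boxLt (fun _ : Fin d => 2 ^ k)

lemma mem_bx {d k : ℕ} {n : Fin d → ℕ} : n ∈ bx d k ↔ ∀ l, n l < 2 ^ k := by
  simp [bx, boxLt]

lemma walshValD_eq {d k : ℕ} {n : Fin d → ℕ} (h : n ∈ bx d k) (m : Fin d → ℕ) :
    walshValD k n m = wPD k n m := by
  unfold walshValD walshD wPD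
  exact Finset.prod_congr rfl fun l _ => walshVal_eq (mem_bx.1 h l) (m l)

lemma wPD_symm {d : ℕ} (k : ℕ) (n m : Fin d → ℕ) : wPD k n m = wPD k m n :=
  Finset.prod_congr rfl fun _ _ => wP_symm _ _ _

lemma wPD_child {d : ℕ} (k : ℕ) (n m : Fin d → ℕ) (σ : Fin d → Fin 2) :
    wPD (k + 1) n (child m σ) = wPD k n m * chi k n σ := by
  unfold wPD chi child
  rw [← Finset.prod_mul_distrib]
  exact Finset.prod_congr rfl fun _ _ => wP_child _ _ _ _

lemma chi_add {d : ℕ} (k : ℕ) (n : Fin d → ℕ) (σ ρ : Fin d → Fin 2) :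
    chi k n (σ + ρ) = chi k n σ * chi k n ρ := by
  unfold chi
  rw [← Finset.prod_mul_distrib]
  exact Finset.prod_congr rfl fun _ _ => eps_add _ _ _ _

lemma chi_lt {d k : ℕ} {n : Fin d → ℕ} (h : n ∈ bx d k) (σ : Fin d → Fin 2) : chi k n σ = 1 :=
  Finset.prod_eq_one fun l _ => eps_lt (mem_bx.1 h l) _

lemma wPD_orth {d : ℕ} (k : ℕ) {m m' : Fin d → ℕ} (h : m ∈ bx d k) (h' : m' ∈ bx d k) :
    ∑ n ∈ bx d k, wPD k n m * wPD k n m' = if m = m' then (2 : ℝ) ^ (k * d) else 0 := by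
  unfold wPD bx boxLt
  simp only [← Finset.prod_mul_distrib]
  rw [Finset.sum_prod_piFinset (range (2 ^ k)) fun l n => wP k n (m l) * wP k n (m' l)]
  simp only [fun l => wP_orth k (m l) (m' l) (mem_bx.1 h l) (mem_bx.1 h' l)]
  by_cases hm : m = m'
  · subst hm
    simp [pow_mul]
  · rw [if_neg hm]
    obtain ⟨l, hl⟩ := Function.ne_iff.1 hm
    exact Finset.prod_eq_zero (Finset.mem_univ l) (by simp [hl])

lemma parseval {d : ℕ} (k : ℕ) (a : (Fin d → ℕ) → ℂ) :
    ∑ m ∈ bx d k, ‖∑ n ∈ bx d k, a n * (wPD k n m : ℂ)‖ ^ 2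
      = (2 : ℝ) ^ (k * d) * ∑ n ∈ bx d k, ‖a n‖ ^ 2 := by
  have key : ∀ n ∈ bx d k, ∀ n' ∈ bx d k, ∑ m ∈ bx d k, (wPD k n m : ℂ) * (wPD k n' m : ℂ)
      = if n = n' then (2 : ℂ) ^ (k * d) else 0 := by
    intro n hn n' hn'
    have := wPD_orth k hn hn'
    simp only [fun x y : Fin d → ℕ => wPD_symm k x y] at this
    have h2 := congrArg (fun x : ℝ => (x : ℂ)) this
    simp only [Complex.ofReal_sum, Complex.ofReal_mul] at h2
    rw [h2]
    split_ifs <;> simp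
  apply Complex.ofReal_injective
  push_cast
  simp only [← Complex.mul_conj']
  calc ∑ m ∈ bx d k, (∑ n ∈ bx d k, a n * (wPD k n m : ℂ)) *
        (starRingEnd ℂ) (∑ n ∈ bx d k, a n * (wPD k n m : ℂ))
      = ∑ m ∈ bx d k, ∑ n ∈ bx d k, ∑ n' ∈ bx d k, a n * (starRingEnd ℂ) (a n') *
          ((wPD k n m : ℂ) * (wPD k n' m : ℂ)) := by
        refine Finset.sum_congr rfl fun m _ => ?_
        rw [map_sum, Finset.sum_mul_sum]
        refine Finset.sum_congr rfl fun n _ => Finset.sum_congr rfl fun n' _ => ?_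
        rw [map_mul, Complex.conj_ofReal]; ring
    _ = ∑ n ∈ bx d k, ∑ n' ∈ bx d k, a n * (starRingEnd ℂ) (a n') *
          ∑ m ∈ bx d k, ((wPD k n m : ℂ) * (wPD k n' m : ℂ)) := by
        rw [Finset.sum_comm]
        refine Finset.sum_congr rfl fun n _ => ?_
        rw [Finset.sum_comm]
        refine Finset.sum_congr rfl fun n' _ => ?_
        rw [Finset.mul_sum]
    _ = ∑ n ∈ bx d k, a n * (starRingEnd ℂ) (a n) * (2 : ℂ) ^ (k * d) := by
        refine Finset.sum_congr rfl fun n hn => ?_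
        rw [Finset.sum_eq_single n]
        · rw [key n hn n hn, if_pos rfl]
        · intro n' hn' hne
          rw [key n hn n' hn', if_neg hne.symm, mul_zero]
        · intro h; exact absurd hn h
    _ = _ := by
        rw [Finset.mul_sum]
        exact Finset.sum_congr rfl fun n _ => by ring

lemma child_mem {d k : ℕ} {m : Fin d → ℕ} (h : m ∈ bx d k) (σ : Fin d → Fin 2) :
    child m σ ∈ bx d (k + 1) := by
  rw [mem_bx] at *
  intro l
  have := h l
  have := (σ l).2
  rw [pow_succ]
  unfold child
  omega

lemma sum_child {d k : ℕ} {M : Type*} [AddCommMonoid M] (f : (Fin d → ℕ) → M) :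
    ∑ m ∈ bx d (k + 1), f m = ∑ m ∈ bx d k, ∑ σ : Fin d → Fin 2, f (child m σ) := by
  rw [← Finset.sum_product']
  symm
  refine Finset.sum_bij' (fun p _ => child p.1 p.2)
    (fun m _ => (fun l => m l / 2, fun l => ⟨m l % 2, by omega⟩)) ?_ ?_ ?_ ?_ ?_
  · intro p hp
    exact child_mem (Finset.mem_product.1 hp).1 _
  · intro m hm
    simp only [Finset.mem_product, Finset.mem_univ, and_true]
    rw [mem_bx] at *
    intro l
    have := hm l
    rw [pow_succ] at this
    omega
  · rintro ⟨m, σ⟩ _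
    ext l
    · simp only [child]; omega
    · simp only [child]; omega
  · intro m _
    ext l
    simp only [child]; omega
  · intro p _; rfl

/-! ### Points, cubes and the set `F` -/

/-- two points have the same first `k` digits in every coordinate. -/
def agree {d : ℕ} (k : ℕ) (g g' : GD d) : Prop := ∀ l t, t < k → g l t = g' l t

lemma agree.symm {d k : ℕ} {g g' : GD d} (h : agree k g g') : agree k g' g :=
  fun l t ht => (h l t ht).symm

lemma agree.trans {d k : ℕ} {g g' g'' : GD d} (h : agree k g g') (h' : agree k g' g'') :
    agree k g g'' :=
  fun l t ht => (h l t ht).trans (h' l t ht)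

lemma agree.mono {d k k' : ℕ} {g g' : GD d} (h : agree k g g') (hk : k' ≤ k) : agree k' g g' :=
  fun l t ht => h l t (lt_of_lt_of_le ht hk)

lemma walshD_agree {d k : ℕ} {n : Fin d → ℕ} (hn : n ∈ bx d k) {g g' : GD d}
    (h : agree k g g') : walshD n g = walshD n g' := by
  unfold walshD
  refine Finset.prod_congr rfl fun l _ => ?_
  rw [walsh_eq (mem_bx.1 hn l), walsh_eq (mem_bx.1 hn l)]
  refine Finset.prod_congr rfl fun t ht => ?_
  rw [h l t (by simpa using ht)]

lemma exists_limit {d : ℕ} (I : ℕ → GD d → Prop)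
    (hI : ∀ k g g', agree k g g' → I k g → I k g') (k0 : ℕ) (g0 : GD d) (h0 : I k0 g0)
    (hstep : ∀ k, k0 ≤ k → ∀ g, I k g → ∃ g', agree k g g' ∧ I (k + 1) g') :
    ∃ g, agree k0 g0 g ∧ ∀ k, k0 ≤ k → I k g := by
  choose f hf using fun (j : ℕ) (g : {g : GD d // I (k0 + j) g}) =>
    hstep (k0 + j) (Nat.le_add_right _ _) g.1 g.2
  let G : (j : ℕ) → {g : GD d // I (k0 + j) g} := fun j =>
    Nat.rec ⟨g0, h0⟩ (fun j g => ⟨f j g, (hf j g).2⟩) j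
  have hG : ∀ j, agree (k0 + j) (G j).1 (G (j + 1)).1 := fun j => (hf j (G j)).1
  have hG' : ∀ j i, agree (k0 + j) (G j).1 (G (j + i)).1 := by
    intro j i
    induction i with
    | zero => exact fun _ _ _ => rfl
    | succ i ih => exact ih.trans ((hG (j + i)).mono (by omega))
  have hlim : ∀ j, agree (k0 + j) (G j).1 (fun l t => (G (t + 1)).1 l t) := by
    intro j l t ht
    show (G j).1 l t = (G (t + 1)).1 l t
    rcases le_total j (t + 1) with h | h
    · obtain ⟨i, hi⟩ := Nat.exists_eq_add_of_le h
      rw [hi]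
      exact hG' j i l t ht
    · obtain ⟨i, rfl⟩ := Nat.exists_eq_add_of_le h
      exact (hG' (t + 1) i l t (by omega)).symm
  refine ⟨_, hlim 0, fun k hk => ?_⟩
  obtain ⟨j, rfl⟩ := Nat.exists_eq_add_of_le hk
  exact hI _ _ _ (hlim j) (G j).2

lemma mem_cube_iff {d k : ℕ} {m : Fin d → ℕ} {g : GD d} :
    g ∈ dyadicCube k m ↔ agree k (cubePoint k m) g := by
  simp only [dyadicCube, dyadicInterval, agree, cubePoint, intervalPoint, Set.mem_ofPred_eq]
  refine forall_congr' fun l => forall_congr' fun t => ?_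
  refine ⟨fun h ht => ?_, fun h ht => ?_⟩
  · rw [h ht]; simp [ht]
  · rw [← h ht]; simp [ht]

lemma agree_child {d : ℕ} (k : ℕ) (m : Fin d → ℕ) (σ : Fin d → Fin 2) :
    agree k (cubePoint k m) (cubePoint (k + 1) (child m σ)) := by
  intro l t ht
  have e : (child m σ l).testBit (k + 1 - 1 - t) = (m l).testBit (k - 1 - t) := by
    have : k + 1 - 1 - t = (k - 1 - t) + 1 := by omega
    rw [this, Nat.testBit_add_one]
    have : child m σ l / 2 = m l := by unfold child; omega
    rw [this]
  simp only [cubePoint, intervalPoint, e]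
  simp [ht, Nat.lt_succ_of_lt ht]

lemma child_bit {d : ℕ} (k : ℕ) (m : Fin d → ℕ) (σ : Fin d → Fin 2) (l : Fin d) :
    cubePoint (k + 1) (child m σ) l k = 1 ↔ σ l = 1 := by
  have e : (child m σ l).testBit (k + 1 - 1 - k) = decide (σ l = 1) := by
    unfold child
    generalize σ l = s
    fin_cases s <;> simp [Nat.testBit_zero]
  simp only [cubePoint, intervalPoint, e]
  simp

lemma exists_cube {d : ℕ} (k : ℕ) (g : GD d) : ∃ m ∈ bx d k, g ∈ dyadicCube k m := by
  refine ⟨fun l => Nat.ofBits (fun i : Fin k => decide (g l (k - 1 - i) = 1)),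
    mem_bx.2 fun l => Nat.ofBits_lt_two_pow _, fun l t ht => ?_⟩
  rw [Nat.testBit_ofBits_lt _ _ (by omega)]
  have : k - 1 - (k - 1 - t) = t := by omega
  simp only [this]
  have h2 : ∀ x : ZMod 2, x = 0 ∨ x = 1 := by decide
  rcases h2 (g l t) with h | h <;> simp [h]

lemma cube_unique {d k : ℕ} {m m' : Fin d → ℕ} (h : m ∈ bx d k) (h' : m' ∈ bx d k)
    {g : GD d} (hg : g ∈ dyadicCube k m) (hg' : g ∈ dyadicCube k m') : m = m' := by
  funext l
  apply Nat.eq_of_testBit_eq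
  intro i
  by_cases hi : i < k
  · have e := (hg l (k - 1 - i) (by omega)).symm.trans (hg' l (k - 1 - i) (by omega))
    have : k - 1 - (k - 1 - i) = i := by omega
    rw [this] at e
    cases h1 : (m l).testBit i <;> cases h2 : (m' l).testBit i <;> simp [h1, h2] at e ⊢
  · have hp : (2 : ℕ) ^ k ≤ 2 ^ i := Nat.pow_le_pow_right (by norm_num) (by omega)
    rw [Nat.testBit_lt_two_pow (lt_of_lt_of_le (mem_bx.1 h l) hp),
      Nat.testBit_lt_two_pow (lt_of_lt_of_le (mem_bx.1 h' l) hp)]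

lemma walsh_two_pow (k : ℕ) (g : DyadicGroup) :
    walsh (2 ^ k) g = if g k = 1 then -1 else 1 := by
  rw [walsh_eq (Nat.pow_lt_pow_right (by norm_num) (Nat.lt_succ_self k)),
    Finset.prod_range_succ, Finset.prod_eq_one]
  · simp [Nat.testBit_two_pow_self]
  · intro t ht
    have ht : t < k := by simpa using ht
    rw [Nat.testBit_two_pow_of_ne (by omega)]
    simp

lemma pm_one (n : ℕ) (g : DyadicGroup) : walsh n g = 1 ∨ walsh n g = -1 := by
  unfold walsh
  refine Finset.prod_induction _ (fun x : ℝ => x = 1 ∨ x = -1) ?_ (Or.inl rfl) ?_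
  · rintro a b (rfl | rfl) (rfl | rfl) <;> simp
  · intro k _; split_ifs <;> simp

lemma pm_oneD {d : ℕ} (n : Fin d → ℕ) (g : GD d) : walshD n g = 1 ∨ walshD n g = -1 := by
  unfold walshD
  refine Finset.prod_induction _ (fun x : ℝ => x = 1 ∨ x = -1) ?_ (Or.inl rfl) ?_
  · rintro a b (rfl | rfl) (rfl | rfl) <;> simp
  · intro k _; exact pm_one _ _

lemma mem_F (d s : ℕ) : ∃ c : GD d → ℝ,
    (∀ g g', agree (2 * mSeq s) g g' → c g = c g') ∧ (∀ g, c g = 1 ∨ c g = -1) ∧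
    ∀ g, g ∈ Fspi (idPerm d) s ↔ walshD (fun _ => 2 ^ (2 * mSeq s)) g = c g := by
  set q := mSeq s with hq
  choose J hJ hJ' using exists_cube (d := d) (2 * q)
  refine ⟨fun g => walshValD q (fun l => J g l / 2 ^ q) (fun l => J g l % 2 ^ q), ?_, ?_, ?_⟩
  · intro g g' h
    have : J g = J g' := cube_unique (hJ g) (hJ g') (hJ' g)
      (mem_cube_iff.2 ((mem_cube_iff.1 (hJ' g')).trans h.symm))
    simp only [this]
  · intro g; exact pm_oneD _ _
  · intro g
    simp only [Fspi, idPerm, Set.mem_iUnion, Set.mem_ofPred_eq, ← hq, exists_prop]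
    constructor
    · rintro ⟨m, hm, m', hm', hg, hw⟩
      have hb : (fun l => 2 ^ q * m l + m' l) ∈ bx d (2 * q) := by
        rw [mem_bx]
        intro l
        have h1 : m l + 1 ≤ 2 ^ q := hm l
        have h2 : m' l < 2 ^ q := hm' l
        calc 2 ^ q * m l + m' l < 2 ^ q * (m l + 1) := by rw [mul_add]; omega
          _ ≤ 2 ^ q * 2 ^ q := Nat.mul_le_mul_left _ h1
          _ = 2 ^ (2 * q) := by ring
      have e := cube_unique (hJ g) hb (hJ' g) hg
      rw [hw, e]
      have hp : 0 < 2 ^ q := by positivity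
      congr 1
      · funext l
        rw [Nat.mul_add_div hp, Nat.div_eq_of_lt (hm' l), add_zero]
      · funext l
        rw [Nat.mul_add_mod, Nat.mod_eq_of_lt (hm' l)]
    · intro h
      refine ⟨fun l => J g l / 2 ^ q, fun l => ?_, fun l => J g l % 2 ^ q,
        fun l => Nat.mod_lt _ (by positivity), ?_, h⟩
      · have := mem_bx.1 (hJ g) l
        rw [Nat.div_lt_iff_lt_mul (by positivity), ← pow_add, ← two_mul]
        exact this
      · simp only [Nat.div_add_mod]
        exact hJ' g

lemma mSeq_succ {s : ℕ} (hs : 1 ≤ s) : mSeq (s + 1) = 4 * mSeq s + 2 := by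
  have : s ≠ 0 := by omega
  rw [mSeq, if_neg this]; ring

lemma mSeq_lt {s : ℕ} (hs : 1 ≤ s) (i : ℕ) : mSeq s + i < mSeq (s + i + 1) := by
  induction i with
  | zero => have := mSeq_succ hs; simp only [add_zero]; omega
  | succ i ih =>
    have := mSeq_succ (s := s + i + 1) (by omega)
    rw [show s + (i + 1) + 1 = s + i + 1 + 1 by ring]
    omega

lemma mSeq_inj {s s' : ℕ} (hs : 1 ≤ s) (hs' : 1 ≤ s') (h : mSeq s = mSeq s') : s = s' := by
  by_contra hne
  rcases lt_or_gt_of_ne hne with hl | hl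
  · obtain ⟨i, rfl⟩ := Nat.exists_eq_add_of_lt hl
    have := mSeq_lt hs i; omega
  · obtain ⟨i, rfl⟩ := Nat.exists_eq_add_of_lt hl
    have := mSeq_lt hs' i; omega

/-- sign of a digit. -/
def sgn (s : Fin 2) : ℝ := if s = 1 then -1 else 1

lemma sgn_add (s r : Fin 2) : sgn (s + r) = sgn s * sgn r := by
  unfold sgn
  fin_cases s <;> fin_cases r <;> simp

/-- sign of a vector of digits. -/
def sgnD {d : ℕ} (σ : Fin d → Fin 2) : ℝ := ∏ l, sgn (σ l)

lemma sgnD_add {d : ℕ} (σ ρ : Fin d → Fin 2) : sgnD (σ + ρ) = sgnD σ * sgnD ρ := by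
  unfold sgnD
  rw [← Finset.prod_mul_distrib]
  exact Finset.prod_congr rfl fun _ _ => sgn_add _ _

lemma sgnD_pm {d : ℕ} (σ : Fin d → Fin 2) : sgnD σ = 1 ∨ sgnD σ = -1 := by
  unfold sgnD
  refine Finset.prod_induction _ (fun x : ℝ => x = 1 ∨ x = -1) ?_ (Or.inl rfl) ?_
  · rintro a b (rfl | rfl) (rfl | rfl) <;> simp
  · intro k _; unfold sgn; split_ifs <;> simp

lemma sgnD_exists {d : ℕ} (hd : 0 < d) {c : ℝ} (hc : c = 1 ∨ c = -1) :
    ∃ σ : Fin d → Fin 2, sgnD σ = c := by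
  rcases hc with rfl | rfl
  · exact ⟨fun _ => 0, by simp [sgnD, sgn]⟩
  · refine ⟨fun l => if l = ⟨0, hd⟩ then 1 else 0, ?_⟩
    unfold sgnD
    rw [Finset.prod_eq_single (⟨0, hd⟩ : Fin d)]
    · simp [sgn]
    · intro l _ hl; simp [sgn, hl]
    · simp

lemma sgnD_card {d : ℕ} (hd : 0 < d) {c : ℝ} (hc : c = 1 ∨ c = -1) :
    (2 : ℝ) * ((Finset.univ.filter fun σ : Fin d → Fin 2 => sgnD σ = c).card : ℝ) = 2 ^ d := by
  have h0 : ∑ σ : Fin d → Fin 2, sgnD σ = 0 := by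
    unfold sgnD
    have := Finset.prod_univ_sum (fun _ : Fin d => (Finset.univ : Finset (Fin 2)))
      (fun _ s => sgn s)
    rw [Fintype.piFinset_univ] at this
    rw [← this]
    apply Finset.prod_eq_zero (Finset.mem_univ ⟨0, hd⟩)
    simp [sgn]
  have h1 : ∀ σ : Fin d → Fin 2, (2 : ℝ) * (if sgnD σ = c then 1 else 0) = 1 + c * sgnD σ := by
    intro σ
    rcases hc with rfl | rfl <;> rcases sgnD_pm σ with h | h <;> rw [h] <;> norm_num
  rw [Finset.card_filter]
  push_cast
  rw [Finset.mul_sum]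
  simp only [h1]
  rw [Finset.sum_add_distrib, ← Finset.mul_sum, h0]
  simp

lemma walshD_two_pow_child {d : ℕ} (k : ℕ) (m : Fin d → ℕ) (σ : Fin d → Fin 2) :
    walshD (fun _ => 2 ^ k) (cubePoint (k + 1) (child m σ)) = sgnD σ := by
  unfold walshD sgnD sgn
  refine Finset.prod_congr rfl fun l _ => ?_
  rw [walsh_two_pow]
  simp only [child_bit]

/-- the conditions involving the first `k` digits hold. -/
def Iv {d : ℕ} (k : ℕ) (g : GD d) : Prop :=
  ∀ s, 1 ≤ s → 2 * mSeq s < k → g ∈ Fspi (idPerm d) s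

lemma F_agree {d s : ℕ} {g g' : GD d} (h : agree (2 * mSeq s + 1) g g') :
    g ∈ Fspi (idPerm d) s ↔ g' ∈ Fspi (idPerm d) s := by
  obtain ⟨c, h1, -, h3⟩ := mem_F d s
  rw [h3, h3, h1 g g' (h.mono (by omega)), walshD_agree (k := 2 * mSeq s + 1) _ h]
  rw [mem_bx]
  exact fun l => Nat.pow_lt_pow_right (by norm_num) (Nat.lt_succ_self _)

lemma Iv_agree {d k : ℕ} {g g' : GD d} (h : agree k g g') (hI : Iv k g) : Iv k g' :=
  fun s hs hk => (F_agree (h.mono hk)).1 (hI s hs hk)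

/-- level `k` is constrained. -/
def special (k : ℕ) : Prop := ∃ s, 1 ≤ s ∧ k = 2 * mSeq s

/-- cube alive. -/
def Av {d : ℕ} (k : ℕ) (m : Fin d → ℕ) : Prop := Iv k (cubePoint k m)

lemma Av_of_child {d k : ℕ} {m : Fin d → ℕ} {σ : Fin d → Fin 2} (h : Av (k + 1) (child m σ)) :
    Av k m :=
  Iv_agree (agree_child k m σ).symm fun s hs hk => h s hs (by omega)

lemma Iv_succ_free {d k : ℕ} (hk : ¬ special k) {g : GD d} (h : Iv k g) : Iv (k + 1) g := by
  intro s hs hlt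
  refine h s hs ?_
  have : k ≠ 2 * mSeq s := fun e => hk ⟨s, hs, e⟩
  omega

lemma Iv_succ_special {d s : ℕ} (hs : 1 ≤ s) {g : GD d} (h : Iv (2 * mSeq s) g)
    (hg : g ∈ Fspi (idPerm d) s) : Iv (2 * mSeq s + 1) g := by
  intro s' hs' hlt
  by_cases e : mSeq s' = mSeq s
  · rw [mSeq_inj hs' hs e]; exact hg
  · exact h s' hs' (by omega)

lemma Av_child_free {d k : ℕ} (hk : ¬ special k) (m : Fin d → ℕ) (σ : Fin d → Fin 2) :
    Av (k + 1) (child m σ) ↔ Av k m :=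
  ⟨Av_of_child, fun h => Iv_succ_free hk (Iv_agree (agree_child k m σ) h)⟩

lemma Av_child_special {d k : ℕ} (hk : special k) (m : Fin d → ℕ) :
    ∃ c : ℝ, (c = 1 ∨ c = -1) ∧ ∀ σ, Av (k + 1) (child m σ) ↔ Av k m ∧ sgnD σ = c := by
  obtain ⟨s, hs, rfl⟩ := hk
  obtain ⟨c, h1, h2, h3⟩ := mem_F d s
  refine ⟨c (cubePoint (2 * mSeq s) m), h2 _, fun σ => ?_⟩
  have key : cubePoint (2 * mSeq s + 1) (child m σ) ∈ Fspi (idPerm d) s ↔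
      sgnD σ = c (cubePoint (2 * mSeq s) m) := by
    rw [h3, walshD_two_pow_child, h1 _ _ (agree_child (2 * mSeq s) m σ)]
  constructor
  · intro h
    exact ⟨Av_of_child h, key.1 (h s hs (by omega))⟩
  · rintro ⟨h, h'⟩
    exact Iv_succ_special hs (Iv_agree (agree_child _ m σ) h) (key.2 h')

lemma Iv_step {d : ℕ} (hd : 0 < d) (k : ℕ) (g : GD d) (h : Iv k g) :
    ∃ g', agree k g g' ∧ Iv (k + 1) g' := by
  obtain ⟨m, hm, hg⟩ := exists_cube k g
  have ha := mem_cube_iff.1 hg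
  have hA : Av k m := Iv_agree ha.symm h
  have : ∃ σ, Av (k + 1) (child m σ) := by
    by_cases hk : special k
    · obtain ⟨c, hc, hc'⟩ := Av_child_special hk m
      obtain ⟨σ, hσ⟩ := sgnD_exists hd hc
      exact ⟨σ, (hc' σ).2 ⟨hA, hσ⟩⟩
    · exact ⟨fun _ => 0, (Av_child_free hk m _).2 hA⟩
  obtain ⟨σ, hσ⟩ := this
  exact ⟨_, ha.symm.trans (agree_child k m σ), hσ⟩

lemma meets_iff {d : ℕ} (hd : 0 < d) (k : ℕ) (m : Fin d → ℕ) :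
    (dyadicCube k m ∩ Fpi (idPerm d)).Nonempty ↔ Av k m := by
  constructor
  · rintro ⟨g, hg, hF⟩
    refine Iv_agree (mem_cube_iff.1 hg).symm fun s hs _ => ?_
    simp only [Fpi, Set.mem_iInter] at hF
    exact hF s hs
  · intro h
    obtain ⟨g, hg, hI⟩ := exists_limit (fun k g => Iv k g) (fun _ _ _ h => Iv_agree h) k _ h
      (fun k _ g => Iv_step hd k g)
    refine ⟨g, mem_cube_iff.2 hg, ?_⟩
    simp only [Fpi, Set.mem_iInter]
    intro s hs
    exact hI (max k (2 * mSeq s + 1)) (le_max_left _ _) s hs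
      (lt_of_lt_of_le (Nat.lt_succ_self _) (le_max_right _ _))

/-- number of surviving subcubes. -/
def Mk (d k : ℕ) : ℝ := if special k then 2 ^ d / 2 else 2 ^ d

lemma Mk_pos (d k : ℕ) : 0 < Mk d k := by unfold Mk; split_ifs <;> positivity

lemma alive_card {d : ℕ} (hd : 0 < d) {k : ℕ} {m : Fin d → ℕ} (h : Av k m) :
    ((Finset.univ.filter fun σ : Fin d → Fin 2 => Av (k + 1) (child m σ)).card : ℝ) = Mk d k := by
  unfold Mk
  split_ifs with hk
  · obtain ⟨c, hc, hc'⟩ := Av_child_special hk m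
    simp only [hc', h, true_and]
    have := sgnD_card hd hc
    linarith
  · simp [Av_child_free hk, h]

/-! ### Quasimeasures -/

lemma genQM_eq {d : ℕ} (ψ : (Fin d → ℕ) → ℂ) (k : ℕ) (m : Fin d → ℕ) :
    genQM ψ k m = ((2 : ℂ) ^ (k * d))⁻¹ * ∑ n ∈ bx d k, ψ n * (wPD k n m : ℂ) := by
  unfold genQM
  congr 1
  exact Finset.sum_congr rfl fun n hn => by rw [walshValD_eq (k := k) hn]

lemma partialSum_eq {d : ℕ} (ψ : (Fin d → ℕ) → ℂ) {k : ℕ} {m : Fin d → ℕ} {g : GD d}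
    (hg : g ∈ dyadicCube k m) :
    walshPartialSum ψ (fun _ => 2 ^ k) g = (2 : ℂ) ^ (k * d) * genQM ψ k m := by
  unfold genQM walshPartialSum walshValD
  rw [mul_inv_cancel_left₀ (pow_ne_zero _ two_ne_zero)]
  exact Finset.sum_congr rfl fun n hn => by
    rw [walshD_agree (k := k) hn (mem_cube_iff.1 hg)]

lemma bx_subset (d k : ℕ) : bx d k ⊆ bx d (k + 1) := by
  intro n hn
  rw [mem_bx] at *
  intro l
  have := hn l
  rw [pow_succ]; omega

lemma sum_chi {d k : ℕ} {n : Fin d → ℕ} (hn : n ∈ bx d (k + 1)) :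
    ∑ σ : Fin d → Fin 2, chi k n σ = if n ∈ bx d k then (2 : ℝ) ^ d else 0 := by
  split_ifs with h
  · simp [chi_lt h]
  · unfold chi
    have := Finset.prod_univ_sum (fun _ : Fin d => (Finset.univ : Finset (Fin 2)))
      (fun l s => eps k (n l) s)
    rw [Fintype.piFinset_univ] at this
    rw [← this]
    rw [mem_bx] at h
    push Not at h
    obtain ⟨l, hl⟩ := h
    have h2 := mem_bx.1 hn l
    obtain ⟨r, hr⟩ := Nat.exists_eq_add_of_le hl
    have hr' : r < 2 ^ k := by rw [pow_succ] at h2; omega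
    apply Finset.prod_eq_zero (Finset.mem_univ l)
    have : (n l).testBit k = true := by
      rw [hr, Nat.testBit_two_pow_add_eq, Nat.testBit_lt_two_pow hr']; rfl
    simp [eps, this]

lemma genQM_add {d : ℕ} (ψ : (Fin d → ℕ) → ℂ) (k : ℕ) (m : Fin d → ℕ) :
    genQM ψ k m = ∑ σ : Fin d → Fin 2, genQM ψ (k + 1) (child m σ) := by
  simp only [genQM_eq, wPD_child]
  rw [← Finset.mul_sum, Finset.sum_comm]
  have : ∀ n ∈ bx d (k + 1), ∑ σ : Fin d → Fin 2, ψ n * ((wPD k n m * chi k n σ : ℝ) : ℂ)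
      = if n ∈ bx d k then (2 : ℂ) ^ d * (ψ n * (wPD k n m : ℂ)) else 0 := by
    intro n hn
    have h := congrArg (fun x : ℝ => (x : ℂ)) (sum_chi hn)
    simp only [Complex.ofReal_sum] at h
    simp only [Complex.ofReal_mul, ← mul_assoc]
    rw [← Finset.mul_sum, h]
    split_ifs <;> simp; ring
  rw [Finset.sum_congr rfl this, ← Finset.sum_filter,
    Finset.filter_mem_eq_inter, Finset.inter_eq_right.2 (bx_subset d k), ← Finset.mul_sum,
    ← mul_assoc]
  congr 1
  rw [show (k + 1) * d = k * d + d by ring, pow_add]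
  field_simp

lemma genQM_vanish {d : ℕ} (hd : 0 < d) (ψ : (Fin d → ℕ) → ℂ)
    (h1 : ∀ g ∉ Fpi (idPerm d), ConvergesOverCubes ψ g 0) (k : ℕ) (m : Fin d → ℕ)
    (hA : ¬ Av k m) : genQM ψ k m = 0 := by
  by_contra hne
  have hself : ∀ (k : ℕ) (m : Fin d → ℕ), cubePoint k m ∈ dyadicCube k m := fun k m =>
    mem_cube_iff.2 fun _ _ _ => rfl
  set c : ℝ := ‖walshPartialSum ψ (fun _ => 2 ^ k) (cubePoint k m)‖ with hc
  have hcpos : 0 < c := by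
    rw [hc, partialSum_eq ψ (hself k m), norm_pos_iff]
    exact mul_ne_zero (pow_ne_zero _ two_ne_zero) hne
  obtain ⟨g, hg, hI⟩ := exists_limit
    (fun k g => c ≤ ‖walshPartialSum ψ (fun _ : Fin d => 2 ^ k) g‖) (by
      intro k g g' h hcg
      have : walshPartialSum ψ (fun _ : Fin d => 2 ^ k) g
          = walshPartialSum ψ (fun _ : Fin d => 2 ^ k) g' :=
        Finset.sum_congr rfl fun n hn => by rw [walshD_agree (k := k) hn h]
      rwa [← this]) k (cubePoint k m) le_rfl (by
      intro k' _ g hcg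
      obtain ⟨m', -, hm'⟩ := exists_cube k' g
      by_contra hcon
      push Not at hcon
      have hlt : ∀ σ : Fin d → Fin 2,
          ‖walshPartialSum ψ (fun _ : Fin d => 2 ^ (k' + 1)) (cubePoint (k' + 1) (child m' σ))‖
            < c := fun σ =>
        hcon _ ((mem_cube_iff.1 hm').symm.trans (agree_child k' m' σ))
      have e : (2 : ℂ) ^ d * walshPartialSum ψ (fun _ : Fin d => 2 ^ k') g
          = ∑ σ : Fin d → Fin 2, walshPartialSum ψ (fun _ : Fin d => 2 ^ (k' + 1))
            (cubePoint (k' + 1) (child m' σ)) := by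
        simp only [partialSum_eq ψ hm', partialSum_eq ψ (hself _ _)]
        rw [← Finset.mul_sum, ← genQM_add]
        ring
      have n1 : (2 : ℝ) ^ d * c ≤ ‖(2 : ℂ) ^ d * walshPartialSum ψ (fun _ : Fin d => 2 ^ k') g‖ := by
        rw [norm_mul, norm_pow, Complex.norm_two]
        exact mul_le_mul_of_nonneg_left hcg (by positivity)
      rw [e] at n1
      have n2 := (norm_sum_le Finset.univ (fun σ : Fin d → Fin 2 =>
        walshPartialSum ψ (fun _ : Fin d => 2 ^ (k' + 1)) (cubePoint (k' + 1) (child m' σ)))).trans_lt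
        (Finset.sum_lt_sum_of_nonempty Finset.univ_nonempty fun σ _ => hlt σ)
      simp at n2
      linarith)
  have hgF : g ∉ Fpi (idPerm d) := fun hF =>
    hA ((meets_iff hd k m).1 ⟨g, mem_cube_iff.2 hg, hF⟩)
  have ht : Tendsto (fun j : ℕ => walshPartialSum ψ (fun _ : Fin d => 2 ^ j) g) atTop (𝓝 0) :=
    (h1 g hgF).comp (tendsto_pow_atTop_atTop_of_one_lt (by norm_num : 1 < 2))
  have ht2 := ht.norm
  rw [norm_zero] at ht2
  have := ge_of_tendsto ht2 (Filter.eventually_atTop.2 ⟨k, fun j hj => hI j hj⟩)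
  linarith

lemma split_sq {d : ℕ} (hd : 0 < d) (ν : ℕ → (Fin d → ℕ) → ℂ) (k : ℕ) (m : Fin d → ℕ)
    (hadd : ν k m = ∑ σ : Fin d → Fin 2, ν (k + 1) (child m σ))
    (hv : ∀ σ, ¬ Av (k + 1) (child m σ) → ν (k + 1) (child m σ) = 0)
    (hconst : ∀ σ σ', Av (k + 1) (child m σ) → Av (k + 1) (child m σ') →
      ν (k + 1) (child m σ) = ν (k + 1) (child m σ')) :
    Mk d k * ∑ σ : Fin d → Fin 2, ‖ν (k + 1) (child m σ)‖ ^ 2 = ‖ν k m‖ ^ 2 := by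
  by_cases h : ∃ σ, Av (k + 1) (child m σ)
  · obtain ⟨σ0, h0⟩ := h
    have hcard := alive_card hd (Av_of_child h0)
    have hval : ∀ σ, ν (k + 1) (child m σ) =
        if Av (k + 1) (child m σ) then ν (k + 1) (child m σ0) else 0 := by
      intro σ
      split_ifs with h
      · exact hconst _ _ h h0
      · exact hv _ h
    have e1 : ν k m = (Mk d k : ℂ) * ν (k + 1) (child m σ0) := by
      rw [hadd, Finset.sum_congr rfl fun σ _ => hval σ, ← Finset.sum_filter, Finset.sum_const,
        nsmul_eq_mul, ← hcard]
      norm_cast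
    have e2 : ∑ σ : Fin d → Fin 2, ‖ν (k + 1) (child m σ)‖ ^ 2
        = Mk d k * ‖ν (k + 1) (child m σ0)‖ ^ 2 := by
      have : ∀ σ, ‖ν (k + 1) (child m σ)‖ ^ 2 =
          if Av (k + 1) (child m σ) then ‖ν (k + 1) (child m σ0)‖ ^ 2 else 0 := by
        intro σ
        rw [hval σ]
        split_ifs <;> simp
      rw [Finset.sum_congr rfl fun σ _ => this σ, ← Finset.sum_filter, Finset.sum_const,
        nsmul_eq_mul, hcard]
    rw [e2, e1, norm_mul, Complex.norm_real, Real.norm_of_nonneg (Mk_pos d k).le]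
    ring
  · push Not at h
    have : ∀ σ, ν (k + 1) (child m σ) = 0 := fun σ => hv σ (h σ)
    rw [hadd]
    simp [this]

/-- energy at level `k`. -/
def En {d : ℕ} (ν : ℕ → (Fin d → ℕ) → ℂ) (k : ℕ) : ℝ := ∑ m ∈ bx d k, ‖ν k m‖ ^ 2

lemma En_rec {d : ℕ} (hd : 0 < d) (ν : ℕ → (Fin d → ℕ) → ℂ) (k : ℕ)
    (hadd : ∀ m ∈ bx d k, ν k m = ∑ σ : Fin d → Fin 2, ν (k + 1) (child m σ))
    (hv : ∀ m ∈ bx d k, ∀ σ, ¬ Av (k + 1) (child m σ) → ν (k + 1) (child m σ) = 0)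
    (hconst : ∀ m ∈ bx d k, ∀ σ σ', Av (k + 1) (child m σ) → Av (k + 1) (child m σ') →
      ν (k + 1) (child m σ) = ν (k + 1) (child m σ')) :
    Mk d k * En ν (k + 1) = En ν k := by
  unfold En
  rw [sum_child, Finset.mul_sum]
  exact Finset.sum_congr rfl fun m hm =>
    split_sq hd ν k m (hadd m hm) (hv m hm) (hconst m hm)

lemma coeff_zero {d : ℕ} (ν : ℕ → (Fin d → ℕ) → ℂ) (k : ℕ) (ρ : Fin d → Fin 2)
    (hinv : ∀ m ∈ bx d k, ∀ σ, ν (k + 1) (child m (σ + ρ)) = ν (k + 1) (child m σ))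
    {n : Fin d → ℕ} (hn : n ∈ bx d (k + 1)) (hχ : chi k n ρ ≠ 1) :
    fourierCoeffAt ν n (k + 1) = 0 := by
  have e : fourierCoeffAt ν n (k + 1) = ∑ m ∈ bx d k, ∑ σ : Fin d → Fin 2,
      ((wPD k n m * chi k n σ : ℝ) : ℂ) * ν (k + 1) (child m σ) := by
    unfold fourierCoeffAt
    refine (sum_child (d := d) (k := k) _).trans ?_
    refine Finset.sum_congr rfl fun m hm => Finset.sum_congr rfl fun σ _ => ?_
    rw [walshValD_eq hn, wPD_child]
  have e2 : fourierCoeffAt ν n (k + 1) = (chi k n ρ : ℂ) * fourierCoeffAt ν n (k + 1) := by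
    conv_lhs => rw [e]
    rw [e, Finset.mul_sum]
    refine Finset.sum_congr rfl fun m hm => ?_
    rw [Finset.mul_sum, ← Equiv.sum_comp (Equiv.addRight ρ)]
    refine Finset.sum_congr rfl fun σ _ => ?_
    simp only [Equiv.coe_addRight]
    rw [hinv m hm, chi_add]
    push_cast
    ring
  have h3 : (1 - (chi k n ρ : ℂ)) * fourierCoeffAt ν n (k + 1) = 0 := by
    rw [sub_mul, one_mul, ← e2, sub_self]
  rcases mul_eq_zero.1 h3 with h | h
  · exfalso
    apply hχ
    have : (chi k n ρ : ℂ) = 1 := (sub_eq_zero.1 h).symm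
    exact_mod_cast this
  · exact h

lemma genQM_inv {d : ℕ} (ψ : (Fin d → ℕ) → ℂ) (k : ℕ) (ρ : Fin d → Fin 2)
    (h : ∀ n ∈ bx d (k + 1), chi k n ρ ≠ 1 → ψ n = 0) (m : Fin d → ℕ) (σ : Fin d → Fin 2) :
    genQM ψ (k + 1) (child m (σ + ρ)) = genQM ψ (k + 1) (child m σ) := by
  simp only [genQM_eq, wPD_child, chi_add]
  congr 1
  refine Finset.sum_congr rfl fun n hn => ?_
  by_cases hχ : chi k n ρ = 1
  · rw [hχ, mul_one]
  · rw [h n hn hχ]; simp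

lemma parseval_gen {d : ℕ} (ψ : (Fin d → ℕ) → ℂ) (k : ℕ) :
    ∑ n ∈ bx d k, ‖ψ n‖ ^ 2 = (2 : ℝ) ^ (k * d) * En (genQM ψ) k := by
  unfold En
  simp only [genQM_eq, norm_mul, mul_pow]
  rw [← Finset.mul_sum, parseval]
  simp only [norm_inv, norm_pow, Complex.norm_two]
  field_simp

lemma parseval_coeff {d : ℕ} (τ : ℕ → (Fin d → ℕ) → ℂ) (k : ℕ) :
    ∑ n ∈ bx d k, ‖fourierCoeffAt τ n k‖ ^ 2 = (2 : ℝ) ^ (k * d) * En τ k := by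
  unfold En
  rw [← parseval k (τ k)]
  refine Finset.sum_congr rfl fun n hn => ?_
  congr 2
  refine Finset.sum_congr rfl fun m hm => ?_
  rw [walshValD_eq hn, wPD_symm, mul_comm]

/-- an admissible translation at level `k`: preserves aliveness of subcubes. -/
def Adm {d : ℕ} (k : ℕ) (ρ : Fin d → Fin 2) : Prop :=
  ∀ m : Fin d → ℕ, ∀ σ, Av (k + 1) (child m (σ + ρ)) ↔ Av (k + 1) (child m σ)

lemma exists_adm {d k : ℕ} {m : Fin d → ℕ} {σ σ' : Fin d → Fin 2}
    (h : Av (k + 1) (child m σ)) (h' : Av (k + 1) (child m σ')) :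
    ∃ ρ, Adm k ρ ∧ σ' = σ + ρ := by
  refine ⟨σ' - σ, ?_, by abel⟩
  intro m1 σ1
  by_cases hk : special k
  · obtain ⟨c, hc, hc'⟩ := Av_child_special hk m
    have e : sgnD (σ' - σ) = 1 := by
      have e1 := ((hc' σ).1 h).2
      have e2 := ((hc' σ').1 h').2
      have e3 : sgnD σ' = sgnD σ * sgnD (σ' - σ) := by rw [← sgnD_add]; congr 1; abel
      rw [e1, e2] at e3
      rcases hc with rfl | rfl <;> linarith
    obtain ⟨c1, -, hc1⟩ := Av_child_special hk m1
    rw [hc1, hc1, sgnD_add, e, mul_one]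
  · rw [Av_child_free hk, Av_child_free hk]
/-- if a Walsh series with coefficients `ψ_𝐧` converges to `0` over cubes
outside `F` and `ψ_𝐧 = o(τ̂_𝐧)` as `max_j n^j → ∞` (`τ = τ_F`), then all `ψ_𝐧 = 0`. -/
theorem statement16 (d : ℕ) (hd : 2 ≤ d) (τ : ℕ → (Fin d → ℕ) → ℂ)
    (hτ : IsTauOf (Fpi (idPerm d)) τ) (ψ : (Fin d → ℕ) → ℂ)
    (h1 : ∀ g ∉ Fpi (idPerm d), ConvergesOverCubes ψ g 0)
    (h2 : ∀ ε : ℝ, 0 < ε → ∃ K : ℕ, ∀ n : Fin d → ℕ, (∃ j, K ≤ n j) →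
      ∀ k : ℕ, (∀ l, n l < 2 ^ k) → ‖ψ n‖ ≤ ε * ‖fourierCoeffAt τ n k‖) :
    ∀ n, ψ n = 0 := by
  have hd0 : 0 < d := by omega
  obtain ⟨hq, hone, hzero, hsplit⟩ := hτ
  have τv : ∀ k, ∀ m ∈ bx d k, ¬ Av k m → τ k m = 0 := by
    intro k m hm h
    rw [hzero k m (mem_bx.1 hm), ← Set.not_nonempty_iff_eq_empty, meets_iff hd0]
    exact h
  have τc : ∀ k, ∀ m ∈ bx d k, ∀ σ σ', Av (k + 1) (child m σ) → Av (k + 1) (child m σ') →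
      τ (k + 1) (child m σ) = τ (k + 1) (child m σ') := by
    intro k m hm σ σ' h h'
    have hne := (meets_iff hd0 k m).2 (Av_of_child h)
    have e := hsplit k m (mem_bx.1 hm) hne σ
    have e' := hsplit k m (mem_bx.1 hm) hne σ'
    have a1 := (meets_iff hd0 (k + 1) (child m σ)).2 h
    unfold child at a1
    rw [if_pos a1] at e
    have a2 := (meets_iff hd0 (k + 1) (child m σ')).2 h'
    unfold child at a2
    rw [if_pos a2] at e'
    exact e.trans e'.symm
  have τrec : ∀ k, Mk d k * En τ (k + 1) = En τ k := fun k =>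
    En_rec hd0 τ k (fun m hm => hq k m (mem_bx.1 hm))
      (fun m hm σ => τv (k + 1) _ (child_mem hm σ)) (τc k)
  have τinv : ∀ k ρ, Adm k ρ → ∀ m ∈ bx d k, ∀ σ,
      τ (k + 1) (child m (σ + ρ)) = τ (k + 1) (child m σ) := by
    intro k ρ hρ m hm σ
    by_cases h : Av (k + 1) (child m σ)
    · exact τc k m hm _ _ ((hρ m σ).2 h) h
    · rw [τv _ _ (child_mem hm _) h, τv _ _ (child_mem hm _) (fun h' => h ((hρ m σ).1 h'))]
  have τpos : ∀ k, 0 < En τ k := by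
    intro k
    induction k with
    | zero =>
      have h0 : (fun _ => 0 : Fin d → ℕ) ∈ bx d 0 := mem_bx.2 fun _ => by norm_num
      refine lt_of_lt_of_le ?_ (Finset.single_le_sum (f := fun m => ‖τ 0 m‖ ^ 2)
        (fun m _ => by positivity) h0)
      simp only [hone]; norm_num
    | succ k ih =>
      rw [← τrec k] at ih
      exact pos_of_mul_pos_right ih (Mk_pos d k).le
  obtain ⟨K, hK⟩ := h2 1 one_pos
  have φv := genQM_vanish hd0 ψ h1
  have φrec : ∀ k, K ≤ k → Mk d k * En (genQM ψ) (k + 1) = En (genQM ψ) k := by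
    intro k hk
    refine En_rec hd0 _ k (fun m _ => genQM_add ψ k m) (fun m _ σ => φv (k + 1) _) ?_
    intro m hm σ σ' h h'
    obtain ⟨ρ, hρ, rfl⟩ := exists_adm h h'
    symm
    apply genQM_inv
    intro n hn hχ
    have hnk : ∃ j, K ≤ n j := by
      by_contra hcon
      push Not at hcon
      exact hχ (chi_lt (mem_bx.2 fun l => lt_of_lt_of_le (hcon l)
        (hk.trans Nat.lt_two_pow_self.le)) ρ)
    have := hK n hnk (k + 1) (mem_bx.1 hn)
    rw [coeff_zero τ k ρ (τinv k ρ hρ) hn hχ] at this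
    simpa using this
  have hratio : ∀ i, En (genQM ψ) (K + i) * En τ K = En (genQM ψ) K * En τ (K + i) := by
    intro i
    induction i with
    | zero => rfl
    | succ i ih =>
      rw [← φrec (K + i) (by omega), ← τrec (K + i)] at ih
      have := (Mk_pos d (K + i)).ne'
      apply mul_left_cancel₀ this
      rw [← add_assoc]
      linarith
  have Ennn : ∀ k, 0 ≤ En (genQM ψ) k := fun k => Finset.sum_nonneg fun _ _ => by positivity
  have hsmall : ∀ ε : ℝ, 0 < ε → En (genQM ψ) K ≤ 2 * ε ^ 2 * En τ K := by
    intro ε hε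
    obtain ⟨K', hK'⟩ := h2 ε hε
    obtain ⟨k, hks, hkK, hkK'⟩ : ∃ k, special k ∧ K ≤ k ∧ K' ≤ k := by
      refine ⟨2 * mSeq (1 + (K + K') + 1), ⟨_, by omega, rfl⟩, ?_, ?_⟩ <;>
      · have := mSeq_lt (le_refl 1) (K + K'); omega
    have hM : Mk d k = 2 ^ d / 2 := by rw [Mk, if_pos hks]
    have hp : (2 : ℝ) ^ ((k + 1) * d) = 2 ^ (k * d) * 2 ^ d := by ring
    have s1 := parseval_gen ψ (k + 1)
    have s2 := parseval_gen ψ k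
    have s3 := parseval_coeff τ (k + 1)
    have r1 := φrec k hkK
    have r2 := τrec k
    rw [hM] at r1 r2
    have hshell : ∑ n ∈ bx d (k + 1) \ bx d k, ‖ψ n‖ ^ 2
        ≤ ε ^ 2 * ∑ n ∈ bx d (k + 1), ‖fourierCoeffAt τ n (k + 1)‖ ^ 2 := by
      rw [Finset.mul_sum]
      refine (Finset.sum_le_sum ?_).trans (Finset.sum_le_sum_of_subset_of_nonneg
        Finset.sdiff_subset fun n _ _ => by positivity)
      intro n hn
      rw [Finset.mem_sdiff] at hn
      have hnk : ∃ j, K' ≤ n j := by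
        by_contra hcon
        push Not at hcon
        exact hn.2 (mem_bx.2 fun l => lt_of_lt_of_le (hcon l)
          (hkK'.trans Nat.lt_two_pow_self.le))
      rw [← mul_pow]
      exact pow_le_pow_left₀ (norm_nonneg _) (hK' n hnk (k + 1) (mem_bx.1 hn.1)) 2
    have hsum := Finset.sum_sdiff (f := fun n => ‖ψ n‖ ^ 2) (bx_subset d k)
    rw [s1, s2] at hsum
    rw [s3] at hshell
    rw [hp] at hsum hshell
    have hP : (0 : ℝ) < 2 ^ (k * d) := by positivity
    have f1 : (2 : ℝ) ^ (k * d) * 2 ^ d * En (genQM ψ) (k + 1)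
        = 2 * (2 ^ (k * d) * En (genQM ψ) k) := by rw [← r1]; ring
    have f2 : ε ^ 2 * ((2 : ℝ) ^ (k * d) * 2 ^ d * En τ (k + 1))
        = 2 ^ (k * d) * (2 * ε ^ 2 * En τ k) := by rw [← r2]; ring
    rw [f1] at hsum
    rw [f2] at hshell
    have hle : En (genQM ψ) k ≤ 2 * ε ^ 2 * En τ k := by
      refine le_of_mul_le_mul_left ?_ hP
      linarith
    obtain ⟨i, rfl⟩ := Nat.exists_eq_add_of_le hkK
    have hr := hratio i
    have ht := τpos (K + i)
    refine le_of_mul_le_mul_right ?_ ht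
    rw [← hr]
    have := mul_le_mul_of_nonneg_right hle (τpos K).le
    linarith
  have hzeroK : En (genQM ψ) K = 0 := by
    refine le_antisymm ?_ (Ennn K)
    by_contra hcon
    push Not at hcon
    have ht := τpos K
    have := hsmall (Real.sqrt (En (genQM ψ) K / (4 * En τ K))) (Real.sqrt_pos.2 (by positivity))
    rw [Real.sq_sqrt (by positivity)] at this
    have e : 2 * (En (genQM ψ) K / (4 * En τ K)) * En τ K = En (genQM ψ) K / 2 := by
      field_simp; norm_num
    linarith
  intro n
  set i := ∑ l, n l with hi
  have hn : n ∈ bx d (K + i) := mem_bx.2 fun l => by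
    have : n l ≤ i := Finset.single_le_sum (f := n) (fun _ _ => Nat.zero_le _) (Finset.mem_univ l)
    exact lt_of_le_of_lt (this.trans (Nat.le_add_left i K)) Nat.lt_two_pow_self
  have hr := hratio i
  rw [hzeroK, zero_mul] at hr
  have hz : En (genQM ψ) (K + i) = 0 := (mul_eq_zero.1 hr).resolve_right (τpos K).ne'
  have hs := parseval_gen ψ (K + i)
  rw [hz, mul_zero, Finset.sum_eq_zero_iff_of_nonneg (fun _ _ => by positivity)] at hs
  simpa using hs n hn
end
end
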